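/- arXiv:2212.04303 — 8 statements merged into one kernel-verified Lean document; each statement's English description precedes it below -/
import Mathlib

section
/- Let σ be a minimal continuous flow on a nonempty compact metric space Ω, let m be a σ-ergodic Borel probability measure on Ω, and let a ∈ R_m(Ω). Define H_a(ω) := inf_{t ∈ ℝ} exp(−∫_0^t a(ω·s) ds) and Ω^a := { ω ∈ Ω : H_a(ω) > 0 }. Then for every ε ∈ (0,1) there exists a subset Ω_ε ⊆ Ω^a with m(Ω_ε) = 1 such that for every ω ∈ Ω_ε the set D_ε(ω) := { t ≥ 0 : H_a(ω·t) ≥ (1−ε)·H_a(ω) } has positive lower density, i.e., liminf_{t→∞} (1/t)·Leb([0,t] ∩ D_ε(ω)) > 0. -/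
open MeasureTheory Filter

/-- A coboundary of a measurable function that is dominated by a bounded function of zero mean
agrees with it almost everywhere. -/
theorem ae_eq_of_comp_sub_le {X : Type*} [MeasurableSpace X] {m : Measure X}
    [IsProbabilityMeasure m] {T : X → X} (hT : MeasurePreserving T m m) {L φ : X → ℝ}
    (hL : Measurable L) (hφ : Measurable φ) {C : ℝ} (hC : ∀ x, |φ x| ≤ C)
    (hφ0 : ∫ x, φ x ∂m = 0) (hle : ∀ᵐ x ∂m, L (T x) - L x ≤ φ x) :
    ∀ᵐ x ∂m, L (T x) - L x = φ x := by
  have hC0 : 0 ≤ C := by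
    obtain ⟨x⟩ : Nonempty X := nonempty_of_isProbabilityMeasure m
    exact (abs_nonneg _).trans (hC x)
  have hdC : ∀ᵐ x ∂m, L (T x) - L x ≤ C := by
    filter_upwards [hle] with x hx using hx.trans ((le_abs_self _).trans (hC x))
  have hLT : Measurable fun x => L (T x) := hL.comp hT.measurable
  let u : ℕ → X → ℝ := fun k x => max (-(k : ℝ)) (min (L x) k)
  have hu : ∀ k, Measurable (u k) := fun k => measurable_const.max (hL.min measurable_const)
  have hui : ∀ k, Integrable (u k) m := fun k => by
    refine Integrable.of_bound (hu k).aestronglyMeasurable (k : ℝ) (ae_of_all _ fun x => ?_)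
    have hk : (0 : ℝ) ≤ k := k.cast_nonneg
    rw [Real.norm_eq_abs, abs_le]
    exact ⟨le_max_left _ _, max_le (by linarith) (min_le_right _ _)⟩
  have huTi : ∀ k, Integrable (fun x => u k (T x)) m := fun k =>
    hT.integrable_comp_of_integrable (hui k)
  have hdi : ∀ k, Integrable (fun x => u k (T x) - u k x) m := fun k => (huTi k).sub (hui k)
  have hCdi : ∀ k, Integrable (fun x => C - (u k (T x) - u k x)) m := fun k =>
    (integrable_const C).sub (hdi k)
  have hu0 : ∀ k, ∫ x, (C - (u k (T x) - u k x)) ∂m = C := fun k => by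
    have h1 : ∫ x, u k (T x) ∂m = ∫ x, u k x ∂m := by
      rw [← integral_map hT.measurable.aemeasurable
        (by rw [hT.map_eq]; exact (hu k).aestronglyMeasurable), hT.map_eq]
    rw [integral_sub (integrable_const _) (hdi k),
      integral_sub (huTi k) (hui k), h1]
    simp
  have hunn : ∀ k, 0 ≤ᵐ[m] fun x => C - (u k (T x) - u k x) := fun k => by
    filter_upwards [hdC] with x hx
    have h1 : u k (T x) ≤ u k x + C := by
      refine max_le ?_ ?_
      · have := le_max_left (-(k : ℝ)) (min (L x) k)
        simp only [u]; linarith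
      · rcases le_total (L x) k with h | h
        · have := le_max_right (-(k : ℝ)) (min (L x) k)
          have h2 := min_le_left (L (T x)) k
          rw [min_eq_left h] at this
          simp only [u]; rw [min_eq_left h]; linarith
        · have := le_max_right (-(k : ℝ)) (min (L x) k)
          have h2 := min_le_right (L (T x)) k
          rw [min_eq_right h] at this
          simp only [u]; rw [min_eq_right h]; linarith
    simp only [Pi.zero_apply]; linarith
  have hlim : ∀ x, Tendsto (fun k => ENNReal.ofReal (C - (u k (T x) - u k x))) atTop
      (nhds (ENNReal.ofReal (C - (L (T x) - L x)))) := fun x => by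
    have hev : ∀ y : ℝ, ∀ᶠ k : ℕ in atTop, max (-(k : ℝ)) (min y k) = y := fun y => by
      obtain ⟨N, hN⟩ := exists_nat_ge |y|
      filter_upwards [eventually_ge_atTop N] with k hk
      have : |y| ≤ k := hN.trans (by exact_mod_cast hk)
      rw [abs_le] at this
      rw [min_eq_left this.2, max_eq_right this.1]
    refine tendsto_const_nhds.congr' ?_
    filter_upwards [hev (L x), hev (L (T x))] with k h1 h2
    simp only [u, h1, h2]
  have hfatou : ∫⁻ x, ENNReal.ofReal (C - (L (T x) - L x)) ∂m ≤ ENNReal.ofReal C := by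
    calc ∫⁻ x, ENNReal.ofReal (C - (L (T x) - L x)) ∂m
        = ∫⁻ x, liminf (fun k => ENNReal.ofReal (C - (u k (T x) - u k x))) atTop ∂m :=
          lintegral_congr fun x => (hlim x).liminf_eq.symm
      _ ≤ liminf (fun k => ∫⁻ x, ENNReal.ofReal (C - (u k (T x) - u k x)) ∂m) atTop :=
          lintegral_liminf_le fun k => (measurable_const.sub
            (((hu k).comp hT.measurable).sub (hu k))).ennreal_ofReal
      _ = ENNReal.ofReal C := by
          have : ∀ k, ∫⁻ x, ENNReal.ofReal (C - (u k (T x) - u k x)) ∂m = ENNReal.ofReal C :=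
            fun k => by
              rw [← ofReal_integral_eq_lintegral_ofReal (hCdi k) (hunn k), hu0 k]
          simp only [this, liminf_const]
  have hnn : 0 ≤ᵐ[m] fun x => C - (L (T x) - L x) := by
    filter_upwards [hdC] with x hx using sub_nonneg.2 hx
  have hmeas : Measurable fun x => C - (L (T x) - L x) := measurable_const.sub (hLT.sub hL)
  have hi : Integrable (fun x => C - (L (T x) - L x)) m :=
    (lintegral_ofReal_ne_top_iff_integrable hmeas.aestronglyMeasurable hnn).1
      (hfatou.trans_lt ENNReal.ofReal_lt_top).ne
  have hφi : Integrable φ m :=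
    Integrable.of_bound hφ.aestronglyMeasurable C (ae_of_all _ hC)
  have hile : ∫ x, (C - (L (T x) - L x)) ∂m ≤ C := by
    rw [← ofReal_integral_eq_lintegral_ofReal hi hnn] at hfatou
    exact (ENNReal.ofReal_le_ofReal_iff hC0).1 hfatou
  have hCφi : Integrable (fun x => C - φ x) m := (integrable_const C).sub hφi
  have hDi : Integrable (fun x => (C - (L (T x) - L x)) - (C - φ x)) m :=
    hi.sub hCφi
  have hDnn : 0 ≤ᵐ[m] fun x => (C - (L (T x) - L x)) - (C - φ x) := by
    filter_upwards [hle] with x hx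
    simp only [Pi.zero_apply]; linarith
  have hD : ∫ x, ((C - (L (T x) - L x)) - (C - φ x)) ∂m = 0 := by
    refine le_antisymm ?_ (integral_nonneg_of_ae hDnn)
    rw [integral_sub hi hCφi,
      integral_sub (integrable_const C) hφi, hφ0]
    simpa using hile
  filter_upwards [(integral_eq_zero_iff_of_nonneg_ae hDnn hDi).1 hD] with x hx
  simp only [Pi.zero_apply] at hx
  linarith

/-- The maximal ergodic theorem. -/
theorem integral_nonneg_of_exists_birkhoffSum_pos {X : Type*} [MeasurableSpace X]
    {m : Measure X} {T : X → X} (hT : MeasurePreserving T m m) {f : X → ℝ}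
    (hf : Measurable f) (hfi : Integrable f m)
    (hpos : ∀ᵐ x ∂m, ∃ n, 0 < birkhoffSum T f n x) : 0 ≤ ∫ x, f x ∂m := by
  let M : ℕ → X → ℝ := fun n => Nat.rec (fun _ => 0) (fun _ g x => max 0 (f x + g (T x))) n
  have hMs : ∀ n x, M (n + 1) x = max 0 (f x + M n (T x)) := fun n x => rfl
  have hM0 : ∀ x, M 0 x = 0 := fun x => rfl
  have hMm : ∀ n, Measurable (M n) := fun n => by
    induction n with
    | zero => exact measurable_const
    | succ n ih => exact measurable_const.max (hf.add (ih.comp hT.measurable))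
  have hMnn : ∀ n x, 0 ≤ M n x := fun n x => by
    cases n with
    | zero => exact le_rfl
    | succ n => exact le_max_left _ _
  have hMi : ∀ n, Integrable (M n) m := fun n => by
    induction n with
    | zero => exact integrable_zero _ _ _
    | succ n ih =>
      exact (integrable_zero X ℝ m).sup (hfi.add (hT.integrable_comp_of_integrable ih))
  have hstep : ∀ n x, M n x ≤ M (n + 1) x := fun n => by
    induction n with
    | zero => exact fun x => le_max_left _ _
    | succ n ih =>
      intro x
      rw [hMs n, hMs (n + 1)]
      exact max_le_max le_rfl (by linarith [ih (T x)])
  have hmono : ∀ x, Monotone fun n => M n x := fun x =>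
    monotone_nat_of_le_succ fun n => hstep n x
  have hS : ∀ n x, birkhoffSum T f n x ≤ M n x := fun n => by
    induction n with
    | zero => intro x; simp [hM0]
    | succ n ih =>
      intro x
      rw [birkhoffSum_succ', hMs]
      exact (by linarith [ih (T x)] : _ ≤ f x + M n (T x)).trans (le_max_right _ _)
  have hms : ∀ n, MeasurableSet {x | 0 < M n x} := fun n =>
    measurableSet_lt measurable_const (hMm n)
  have hMTi : ∀ n, Integrable (fun x => M n (T x)) m := fun n =>
    hT.integrable_comp_of_integrable (hMi n)
  have hint : ∀ n, 0 ≤ ∫ x in {x | 0 < M n x}, f x ∂m := fun n => by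
    have h1 : ∫ x, (M n x - M n (T x)) ∂m = 0 := by
      rw [integral_sub (hMi n) (hMTi n),
        ← integral_map (f := M n) hT.measurable.aemeasurable
        (by rw [hT.map_eq]; exact (hMm n).aestronglyMeasurable), hT.map_eq, sub_self]
    rw [← integral_indicator (hms n)]
    refine h1.ge.trans ?_
    refine integral_mono ((hMi n).sub (hMTi n))
      (hfi.indicator (hms n)) fun x => ?_
    by_cases hx : 0 < M n x
    · rw [Set.indicator_of_mem (by exact hx)]
      cases n with
      | zero => exact absurd hx (lt_irrefl _)
      | succ n =>
        have h2 := hstep n (T x)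
        have h3 : M (n + 1) x = f x + M n (T x) := by
          rw [hMs] at hx ⊢
          rcases max_cases 0 (f x + M n (T x)) with h | h
          · rw [h.1] at hx; exact absurd hx (lt_irrefl _)
          · exact h.1
        simp only
        linarith
    · rw [Set.indicator_of_notMem (by exact hx)]
      have := hMnn n (T x)
      simp only
      linarith [not_lt.1 hx]
  have hlim := tendsto_setIntegral_of_monotone (μ := m) (f := f) hms
    (fun i j hij x (hx : 0 < M i x) => hx.trans_le (hmono x hij)) hfi.integrableOn
  have hU : ∫ x in ⋃ n, {x | 0 < M n x}, f x ∂m = ∫ x, f x ∂m := by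
    rw [← setIntegral_univ (μ := m) (f := f)]
    refine setIntegral_congr_set ?_
    filter_upwards [hpos] with x ⟨n, hn⟩
    refine eq_iff_iff.2 ⟨fun _ => trivial, fun _ => ?_⟩
    exact Set.mem_iUnion.2 ⟨n, hn.trans_le (hS n x)⟩
  rw [hU] at hlim
  exact ge_of_tendsto' hlim hint

theorem abs_intervalIntegral_flow_le {Ω : Type*} {σ : ℝ → Ω → Ω} {f : Ω → ℝ} {C : ℝ}
    (hC : ∀ ω, |f ω| ≤ C) (ω : Ω) (t : ℝ) :
    |∫ s in (0 : ℝ)..t, f (σ s ω)| ≤ C * |t| := by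
  have := intervalIntegral.norm_integral_le_of_norm_le_const (a := 0) (b := t)
    (f := fun s => f (σ s ω)) (C := C) fun s _ => hC _
  simpa using this

section MeasurableFlow

variable {Ω : Type*} [MeasurableSpace Ω] {σ : ℝ → Ω → Ω} {m : Measure Ω} {f : Ω → ℝ}

theorem intervalIntegrable_flow (hσ : Measurable fun p : ℝ × Ω => σ p.1 p.2)
    (hf : Measurable f) {C : ℝ} (hC : ∀ ω, |f ω| ≤ C) (ω : Ω) (x y : ℝ) :
    IntervalIntegrable (fun s => f (σ s ω)) volume x y := by
  rw [intervalIntegrable_iff]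
  exact Measure.integrableOn_of_bounded (M := C) measure_Ioc_lt_top.ne
    (hf.comp (hσ.comp measurable_prodMk_right)).aestronglyMeasurable (ae_of_all _ fun s => hC _)

theorem intervalIntegral_flow_add (hσ : Measurable fun p : ℝ × Ω => σ p.1 p.2)
    (hσadd : ∀ s t ω, σ (s + t) ω = σ s (σ t ω))
    (hf : Measurable f) {C : ℝ} (hC : ∀ ω, |f ω| ≤ C) (ω : Ω) (r t : ℝ) :
    ∫ s in (0 : ℝ)..(r + t), f (σ s ω) =
      (∫ s in (0 : ℝ)..r, f (σ s ω)) + ∫ s in (0 : ℝ)..t, f (σ s (σ r ω)) := by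
  have h : ∫ s in (0 : ℝ)..t, f (σ s (σ r ω)) = ∫ s in r..(r + t), f (σ s ω) := by
    simp only [← hσadd]
    rw [intervalIntegral.integral_comp_add_right (fun s => f (σ s ω)), zero_add, add_comm t r]
  rw [h, intervalIntegral.integral_add_adjacent_intervals] <;>
    exact intervalIntegrable_flow hσ hf hC ω _ _

theorem measurable_intervalIntegral_flow (hσ : Measurable fun p : ℝ × Ω => σ p.1 p.2)
    (hf : Measurable f) (t : ℝ) : Measurable fun ω => ∫ s in (0 : ℝ)..t, f (σ s ω) := by
  have h : StronglyMeasurable (Function.uncurry fun (ω : Ω) (s : ℝ) => f (σ s ω)) :=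
    (hf.comp (hσ.comp measurable_swap)).stronglyMeasurable
  exact h.integral_prod_right.measurable.sub h.integral_prod_right.measurable

theorem integral_intervalIntegral_flow [IsFiniteMeasure m]
    (hσ : Measurable fun p : ℝ × Ω => σ p.1 p.2) (hm : ∀ t, MeasurePreserving (σ t) m m)
    (hf : Measurable f) {C : ℝ} (hC : ∀ ω, |f ω| ≤ C) (t : ℝ) :
    ∫ ω, (∫ s in (0 : ℝ)..t, f (σ s ω)) ∂m = t * ∫ ω, f ω ∂m := by
  have h : ∀ s, ∫ ω, f (σ s ω) ∂m = ∫ ω, f ω ∂m := fun s => by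
    rw [← integral_map (f := f) (hm s).measurable.aemeasurable
      (by rw [(hm s).map_eq]; exact hf.aestronglyMeasurable), (hm s).map_eq]
  rw [← intervalIntegral_integral_swap]
  · simp [h]
  · have : IsFiniteMeasure (volume.restrict (Set.uIoc 0 t)) :=
      ⟨by rw [Measure.restrict_apply_univ]; exact measure_Ioc_lt_top⟩
    exact Integrable.of_bound (hf.comp hσ).aestronglyMeasurable C (ae_of_all _ fun p => hC _)

/-- Along almost every orbit of an ergodic flow, the time averages of a bounded nonnegative function
with positive mean stay away from zero. -/
theorem ae_exists_le_mul_intervalIntegral_flow [IsProbabilityMeasure m]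
    (hσ : Measurable fun p : ℝ × Ω => σ p.1 p.2)
    (hσ0 : ∀ ω, σ 0 ω = ω) (hσadd : ∀ s t ω, σ (s + t) ω = σ s (σ t ω))
    (hm : ∀ t, MeasurePreserving (σ t) m m)
    (herg : ∀ B : Set Ω, MeasurableSet B → (∀ t, σ t ⁻¹' B = B) → m B = 0 ∨ m B = 1)
    (hf : Measurable f) {C : ℝ} (hC : ∀ ω, |f ω| ≤ C) (hpos : 0 < ∫ ω, f ω ∂m) :
    ∀ᵐ ω ∂m, ∃ k N : ℕ, ∀ n ≥ N, (n : ℝ) ≤ (k + 1) * ∫ s in (0 : ℝ)..n, f (σ s ω) := by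
  let G : ℝ → Ω → ℝ := fun t ω => ∫ s in (0 : ℝ)..t, f (σ s ω)
  have hGadd : ∀ r t ω, G (r + t) ω = G r ω + G t (σ r ω) := fun r t ω =>
    intervalIntegral_flow_add hσ hσadd hf hC ω r t
  have hGm : ∀ t, Measurable (G t) := fun t => measurable_intervalIntegral_flow hσ hf t
  have hGle : ∀ t ω, |G t ω| ≤ C * |t| := fun t ω => abs_intervalIntegral_flow_le hC ω t
  have hGint : ∀ t, ∫ ω, G t ω ∂m = t * ∫ ω, f ω ∂m := fun t =>
    integral_intervalIntegral_flow hσ hm hf hC t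
  have hGi : ∀ t, Integrable (G t) m := fun t =>
    Integrable.of_bound (hGm t).aestronglyMeasurable _ (ae_of_all _ (hGle t))
  let B : Set Ω := {ω | ∃ k N : ℕ, ∀ n : ℕ, n ≥ N → (n : ℝ) ≤ (k + 1) * G n ω}
  have hBm : MeasurableSet B := by
    have : B = ⋃ k : ℕ, ⋃ N : ℕ, ⋂ n : ℕ, ⋂ _ : n ≥ N, {ω | (n : ℝ) ≤ (k + 1) * G n ω} := by
      ext ω; simp [B]
    rw [this]
    exact .iUnion fun k => .iUnion fun N => .iInter fun n => .iInter fun _ =>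
      measurableSet_le measurable_const (measurable_const.mul (hGm n))
  have hBsub : ∀ t ω, ω ∈ B → σ t ω ∈ B := by
    rintro t ω ⟨k, N, h⟩
    obtain ⟨N', hN'⟩ := exists_nat_ge (4 * (k + 1) * (C * |t|))
    refine ⟨2 * k + 1, max N N', fun n hn => ?_⟩
    have h1 := h n ((le_max_left _ _).trans hn)
    have h2 : (N' : ℝ) ≤ n := by exact_mod_cast (le_max_right _ _).trans hn
    have h3 := hGadd t n ω
    have h4 := hGadd n t ω
    rw [add_comm (n : ℝ) t] at h4
    have h5 := abs_le.1 (hGle t ω)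
    have h6 := abs_le.1 (hGle t (σ n ω))
    have h7 : G n ω ≤ G n (σ t ω) + 2 * (C * |t|) := by linarith [h5.1, h5.2, h6.1, h6.2]
    have h8 : ((k : ℝ) + 1) * G n ω ≤ (k + 1) * (G n (σ t ω) + 2 * (C * |t|)) := by gcongr
    push_cast
    nlinarith
  have hBinv : ∀ t, σ t ⁻¹' B = B := fun t => by
    refine Set.Subset.antisymm (fun ω hω => ?_) (fun ω hω => hBsub t ω hω)
    have := hBsub (-t) _ hω
    rwa [← hσadd, neg_add_cancel, hσ0] at this
  rcases herg B hBm hBinv with h0 | h1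
  · exfalso
    obtain ⟨k, hk⟩ := exists_nat_one_div_lt hpos
    have hS : ∀ (n : ℕ) ω, birkhoffSum (σ 1) (fun ω => 1 / ((k : ℝ) + 1) - G 1 ω) n ω =
        n * (1 / ((k : ℝ) + 1)) - G n ω := fun n => by
      induction n with
      | zero => intro ω; simp [G]
      | succ n ih =>
        intro ω
        rw [birkhoffSum_succ', ih]
        have := hGadd 1 n ω
        rw [add_comm (1 : ℝ) n] at this
        push_cast
        rw [this]; ring
    have hae : ∀ᵐ ω ∂m,
        ∃ n, 0 < birkhoffSum (σ 1) (fun ω => 1 / ((k : ℝ) + 1) - G 1 ω) n ω := by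
      filter_upwards [measure_eq_zero_iff_ae_notMem.1 h0] with ω hω
      by_contra! hcon
      refine hω ⟨k, 0, fun n _ => ?_⟩
      have := hcon n
      rw [hS] at this
      have hk1 : (0 : ℝ) < k + 1 := by positivity
      have h2 : (n : ℝ) * (1 / (k + 1)) ≤ G n ω := by linarith
      rw [mul_one_div, div_le_iff₀ hk1] at h2
      linarith
    have := integral_nonneg_of_exists_birkhoffSum_pos (hm 1) (measurable_const.sub (hGm 1))
      ((integrable_const _).sub (hGi 1)) hae
    rw [integral_sub' (integrable_const _) (hGi 1), hGint, integral_const, probReal_univ, one_smul,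
      one_mul] at this
    linarith
  · exact mem_ae_iff_prob_eq_one hBm |>.2 h1

end MeasurableFlow

section ContinuousFlow

variable {Ω : Type*} [TopologicalSpace Ω] [MeasurableSpace Ω] [BorelSpace Ω]

theorem measurable_iInf_of_continuous_of_nonneg {ι : Type*} [Nonempty ι] {F : ι → Ω → ℝ}
    (hF : ∀ i, Continuous (F i)) (h0 : ∀ i ω, 0 ≤ F i ω) : Measurable fun ω => ⨅ i, F i ω := by
  refine measurable_of_Ici fun c => ?_
  have : (fun ω => ⨅ i, F i ω) ⁻¹' Set.Ici c = ⋂ i, {ω | c ≤ F i ω} := by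
    ext ω
    simp only [Set.mem_preimage, Set.mem_Ici, Set.mem_iInter, Set.mem_ofPred_eq]
    exact le_ciInf_iff ⟨0, by rintro _ ⟨i, rfl⟩; exact h0 i ω⟩
  rw [this]
  exact (isClosed_iInter fun i => isClosed_le continuous_const (hF i)).measurableSet

theorem bddBelow_range_exp {ι : Type*} (g : ι → ℝ) :
    BddBelow (Set.range fun i => Real.exp (g i)) :=
  ⟨0, by rintro _ ⟨i, rfl⟩; exact (Real.exp_pos _).le⟩

/-- If the primitive of a function of zero mean is bounded above on the negative half of almost
every orbit, then it is bounded above on almost every orbit. -/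
theorem ae_iInf_exp_neg_intervalIntegral_flow_pos {m : Measure Ω} [IsProbabilityMeasure m]
    {σ : ℝ → Ω → Ω} (hσcont : Continuous fun p : ℝ × Ω => σ p.1 p.2)
    (hσ : Measurable fun p : ℝ × Ω => σ p.1 p.2)
    (hσadd : ∀ s t ω, σ (s + t) ω = σ s (σ t ω))
    (hm : ∀ t, MeasurePreserving (σ t) m m) {a : Ω → ℝ} (ha : Continuous a) {C : ℝ}
    (hC : ∀ ω, |a ω| ≤ C) (hint : ∫ ω, a ω ∂m = 0)
    (hbdd : ∀ᵐ ω ∂m, ∃ K : ℝ, ∀ t ≤ (0:ℝ), (∫ s in (0:ℝ)..t, a (σ s ω)) ≤ K) :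
    ∀ᵐ ω ∂m, 0 < ⨅ t : ℝ, Real.exp (-(∫ s in (0:ℝ)..t, a (σ s ω))) := by
  let A : ℝ → Ω → ℝ := fun t ω => ∫ s in (0 : ℝ)..t, a (σ s ω)
  have hAadd : ∀ r t ω, A (r + t) ω = A r ω + A t (σ r ω) := fun r t ω =>
    intervalIntegral_flow_add hσ hσadd ha.measurable hC ω r t
  have hAc : ∀ t, Continuous (A t) := fun t =>
    intervalIntegral.continuous_parametric_intervalIntegral_of_continuous'
      (f := fun ω s => a (σ s ω)) (by exact ha.comp (hσcont.comp continuous_swap)) 0 t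
  let P : Ω → ℝ := fun ω => ⨅ t : Set.Iic (0 : ℝ), Real.exp (-A t ω)
  have hPm : Measurable P := measurable_iInf_of_continuous_of_nonneg
    (fun t => Real.continuous_exp.comp (hAc t).neg) fun t ω => (Real.exp_pos _).le
  have hPle : ∀ ω t, t ≤ 0 → P ω ≤ Real.exp (-A t ω) := fun ω t ht =>
    ciInf_le (bddBelow_range_exp fun t : Set.Iic (0 : ℝ) => -A t ω) ⟨t, ht⟩
  have hPpos : ∀ᵐ ω ∂m, 0 < P ω := by
    filter_upwards [hbdd] with ω ⟨K, hK⟩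
    exact (Real.exp_pos (-K)).trans_le <|
      le_ciInf fun t => Real.exp_le_exp.2 (neg_le_neg (hK t t.2))
  have hPσ : ∀ r ω, 0 ≤ r → P (σ r ω) ≤ Real.exp (A r ω) * P ω := fun r ω hr => by
    rw [← div_le_iff₀' (Real.exp_pos _)]
    refine le_ciInf fun t => ?_
    have h1 := hPle (σ r ω) (t - r) (by linarith [t.2.out])
    have h2 := hAadd r (t - r) ω
    rw [add_sub_cancel] at h2
    rw [div_le_iff₀' (Real.exp_pos _), ← Real.exp_add, h2]
    exact h1.trans_eq (congrArg Real.exp (by ring))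
  have hae : ∀ n : ℕ, ∀ᵐ ω ∂m, Real.log (P (σ n ω)) - Real.log (P ω) = A n ω := fun n => by
    refine ae_eq_of_comp_sub_le (hm n) (Real.measurable_log.comp hPm) (hAc n).measurable
      (abs_intervalIntegral_flow_le hC · n) ?_ ?_
    · rw [integral_intervalIntegral_flow hσ hm ha.measurable hC, hint, mul_zero]
    · filter_upwards [hPpos, (hm n).quasiMeasurePreserving.ae hPpos] with ω h1 h2
      have := Real.log_le_log h2 (hPσ n ω n.cast_nonneg)
      rw [Real.log_mul (Real.exp_pos _).ne' h1.ne', Real.log_exp] at this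
      simp only [Function.comp_apply]
      linarith
  filter_upwards [hPpos, ae_all_iff.2 hae, ae_all_iff.2 fun n : ℕ =>
    (hm n).quasiMeasurePreserving.ae hPpos] with ω h1 h2 h3
  refine h1.trans_le (le_ciInf fun t => ?_)
  obtain ⟨n, hn⟩ := exists_nat_ge t
  have h4 := Real.log_le_log (h3 n) (hPle (σ n ω) (t - n) (by linarith))
  rw [Real.log_exp] at h4
  have h5 := hAadd n (t - n) ω
  rw [add_sub_cancel] at h5
  rw [← Real.log_le_iff_le_exp h1]
  change _ ≤ -A t ω
  linarith [h2 n]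

end ContinuousFlow

/-- STATEMENT 9: For `a ∈ R_m(Ω)` and `ε ∈ (0,1)`, for `m`-almost every `ω` in
`Ω^a = {H_a > 0}` the set `D_ε(ω) = {t ≥ 0 : H_a(ω·t) ≥ (1−ε) H_a(ω)}` has positive lower
density. -/
theorem stmt10 {Ω : Type*} [MetricSpace Ω] [CompactSpace Ω] [Nonempty Ω]
    [MeasurableSpace Ω] [BorelSpace Ω]
    (σ : ℝ → Ω → Ω)
    (hσcont : Continuous fun p : ℝ × Ω => σ p.1 p.2)
    (hσ0 : ∀ ω, σ 0 ω = ω)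
    (hσadd : ∀ s t ω, σ (s + t) ω = σ s (σ t ω))
    (hmin : ∀ ω : Ω, Dense (Set.range fun t => σ t ω))
    (m : Measure Ω) [IsProbabilityMeasure m]
    (hminv : ∀ t, Measure.map (σ t) m = m)
    (herg : ∀ B : Set Ω, MeasurableSet B → (∀ t, σ t ⁻¹' B = B) → m B = 0 ∨ m B = 1)
    (a : Ω → ℝ) (ha : Continuous a)
    (hint : ∫ ω, a ω ∂m = 0)
    (hnoprim : ¬ ∃ h : Ω → ℝ, Continuous h ∧
      ∀ ω t, h (σ t ω) - h ω = ∫ s in (0:ℝ)..t, a (σ s ω))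
    (hbdd : ∀ᵐ ω ∂m, ∃ C : ℝ, ∀ t ≤ (0:ℝ), (∫ s in (0:ℝ)..t, a (σ s ω)) ≤ C)
    (Ha : Ω → ℝ)
    (hHa : ∀ ω, Ha ω = ⨅ t : ℝ, Real.exp (-(∫ s in (0:ℝ)..t, a (σ s ω))))
    (ε : ℝ) (hε : ε ∈ Set.Ioo (0:ℝ) 1) :
    ∃ Ωε : Set Ω, Ωε ⊆ {ω : Ω | 0 < Ha ω} ∧ m Ωε = 1 ∧
      ∀ ω ∈ Ωε,
        0 < Filter.liminf
            (fun T : ℝ =>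
              (volume (Set.Icc (0:ℝ) T ∩ {t : ℝ | 0 ≤ t ∧ (1 - ε) * Ha ω ≤ Ha (σ t ω)})).toReal / T)
            Filter.atTop := by
  have hσ : Measurable fun p : ℝ × Ω => σ p.1 p.2 := hσcont.measurable
  have hm : ∀ t, MeasurePreserving (σ t) m m := fun t =>
    ⟨hσ.comp measurable_prodMk_left, hminv t⟩
  obtain ⟨C, hC⟩ : ∃ C : ℝ, ∀ ω, |a ω| ≤ C := by
    obtain ⟨C, hC⟩ := isCompact_univ.exists_bound_of_continuousOn ha.continuousOn
    exact ⟨C, fun ω => hC ω trivial⟩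
  have hHpos : ∀ᵐ ω ∂m, 0 < Ha ω := by
    simp only [hHa]
    exact ae_iInf_exp_neg_intervalIntegral_flow_pos hσcont hσ hσadd hm ha hC hint hbdd
  have hHm : Measurable Ha := by
    rw [show Ha = _ from funext hHa]
    refine measurable_iInf_of_continuous_of_nonneg (fun t => ?_) fun t ω => (Real.exp_pos _).le
    exact Real.continuous_exp.comp
      (intervalIntegral.continuous_parametric_intervalIntegral_of_continuous'
        (f := fun ω s => a (σ s ω)) (by exact ha.comp (hσcont.comp continuous_swap)) 0 t).neg
  have hH1 : ∀ ω, Ha ω ≤ 1 := fun ω => by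
    rw [hHa]
    simpa using ciInf_le (bddBelow_range_exp fun t : ℝ => -∫ s in (0:ℝ)..t, a (σ s ω)) 0
  -- `S` is the essential supremum of `Ha`.
  obtain ⟨S, hSle, hSpos⟩ : ∃ S : ℝ, (∀ᵐ ω ∂m, Ha ω ≤ S) ∧ 0 < m {ω | (1 - ε) * S ≤ Ha ω} := by
    have hbb : IsBoundedUnder (· ≤ ·) (ae m) Ha := ⟨1, by simp [hH1]⟩
    have hle : ∀ᵐ ω ∂m, Ha ω ≤ essSup Ha m := ae_le_essSup hbb
    refine ⟨essSup Ha m, hle, ?_⟩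
    have hS0 : 0 < essSup Ha m := by
      obtain ⟨ω, h1, h2⟩ := (hHpos.and hle).exists
      exact h1.trans_le h2
    rw [pos_iff_ne_zero]
    intro h0
    have hlt : ∀ᵐ ω ∂m, Ha ω ≤ (1 - ε) * essSup Ha m := by
      filter_upwards [measure_eq_zero_iff_ae_notMem.1 h0] with ω hω
      exact (not_le.1 hω).le
    have hcob : IsCoboundedUnder (· ≤ ·) (ae m) Ha :=
      IsBoundedUnder.isCoboundedUnder_le ⟨0, by
        rw [eventually_map]; exact hHpos.mono fun ω h => h.le⟩
    have := essSup_le_of_ae_le _ hlt hcob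
    nlinarith [hε.1]
  let E : Set Ω := {ω | (1 - ε) * S ≤ Ha ω}
  have hE : MeasurableSet E := measurableSet_le measurable_const hHm
  let f : Ω → ℝ := E.indicator 1
  have hf : Measurable f := measurable_one.indicator hE
  have hf1 : ∀ ω, |f ω| ≤ 1 := fun ω => by
    by_cases h : ω ∈ E <;> simp [f, h]
  have hfpos : 0 < ∫ ω, f ω ∂m := by
    rw [integral_indicator_one hE, measureReal_def]
    exact ENNReal.toReal_pos hSpos.ne' (measure_ne_top _ _)
  have hdens := ae_exists_le_mul_intervalIntegral_flow hσ hσ0 hσadd hm herg hf hf1 hfpos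
  refine ⟨{ω | 0 < Ha ω ∧ Ha ω ≤ S ∧
    ∃ k N : ℕ, ∀ n ≥ N, (n : ℝ) ≤ (k + 1) * ∫ s in (0 : ℝ)..n, f (σ s ω)},
    fun ω h => h.1, ?_, ?_⟩
  · rw [← measure_univ (μ := m)]
    refine measure_congr (eventuallyEq_univ.2 ?_)
    filter_upwards [hHpos, hSle, hdens] with ω h1 h2 h3 using ⟨h1, h2, h3⟩
  rintro ω ⟨-, h2, k, N, hN⟩
  set D : Set ℝ := {t : ℝ | 0 ≤ t ∧ (1 - ε) * Ha ω ≤ Ha (σ t ω)}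
  have hfin : ∀ T : ℝ, volume (Set.Icc 0 T ∩ D) ≠ ⊤ := fun T =>
    ((measure_mono Set.inter_subset_left).trans_lt measure_Icc_lt_top).ne
  have hvol : ∀ n : ℕ, ∀ T : ℝ, (n : ℝ) ≤ T →
      ∫ s in (0 : ℝ)..n, f (σ s ω) ≤ (volume (Set.Icc 0 T ∩ D)).toReal := fun n T hT => by
    let E' : Set ℝ := {s | σ s ω ∈ E}
    have hE' : MeasurableSet E' := (hσ.comp measurable_prodMk_right) hE
    rw [intervalIntegral.integral_of_le n.cast_nonneg]
    change ∫ s in Set.Ioc (0 : ℝ) n, E'.indicator 1 s ≤ _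
    rw [integral_indicator_one hE', measureReal_restrict_apply hE', measureReal_def]
    refine ENNReal.toReal_mono (hfin T) (measure_mono ?_)
    rintro s ⟨hs, hs0, hsn⟩
    refine ⟨⟨hs0.le, hsn.trans hT⟩, hs0.le, le_trans ?_ (show (1 - ε) * S ≤ Ha (σ s ω) from hs)⟩
    exact mul_le_mul_of_nonneg_left h2 (by linarith [hε.2])
  have hk : (0 : ℝ) < 1 / (2 * (k + 1)) := by positivity
  refine hk.trans_le (le_liminf_of_le ?_ ?_)
  · refine IsBoundedUnder.isCoboundedUnder_ge ⟨1, ?_⟩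
    rw [eventually_map]
    filter_upwards [eventually_gt_atTop 0] with T hT
    rw [div_le_one hT]
    calc (volume (Set.Icc 0 T ∩ D)).toReal ≤ (volume (Set.Icc 0 T)).toReal :=
          ENNReal.toReal_mono measure_Icc_lt_top.ne (measure_mono Set.inter_subset_left)
      _ = T := by simp [hT.le]
  · filter_upwards [eventually_ge_atTop ((N : ℝ) + 2)] with T hT
    have hN0 : (0 : ℝ) ≤ N := N.cast_nonneg
    have h3 := Nat.lt_floor_add_one T
    have h4 := Nat.floor_le (show 0 ≤ T by linarith)
    have h5 := hN ⌊T⌋₊ (Nat.le_floor (by linarith))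
    have h6 := hvol _ T h4
    have hk1 : (0 : ℝ) < k + 1 := by positivity
    have h7 := mul_le_mul_of_nonneg_left h6 hk1.le
    rw [div_le_div_iff₀ (by positivity) (by linarith)]
    linarith
end

section
/- Let σ be a continuous flow on a nonempty compact metric space Ω. Assume that σ is topologically transitive (for any two nonempty open sets U, V ⊆ Ω there exists t > 0 with σ(t,U) ∩ V ≠ ∅) and that there exists a σ-invariant Borel probability measure m on Ω whose topological support is all of Ω. Then either (1) σ is minimal and equicontinuous, or (2) σ is sensitive with respect to initial conditions; in the latter case σ is Auslander–Yorke chaotic (topologically transitive and sensitive). -/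
open MeasureTheory

section Flow

open Set

theorem iterate_flow {Ω : Type*} {σ : ℝ → Ω → Ω} (hσ0 : ∀ ω, σ 0 ω = ω)
    (hσadd : ∀ s t ω, σ (s + t) ω = σ s (σ t ω)) (t : ℝ) (n : ℕ) (ω : Ω) :
    (σ t)^[n] ω = σ (n * t) ω := by
  induction n with
  | zero => simp [hσ0]
  | succ n ih =>
    rw [Function.iterate_succ_apply', ih, ← hσadd]
    congr 1
    push_cast
    ring

variable {Ω : Type*} [MetricSpace Ω] {σ : ℝ → Ω → Ω}

/-- The points having a neighbourhood all of whose forward orbits stay `ε`-close. -/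
def forwardStable (σ : ℝ → Ω → Ω) (ε : ℝ) : Set Ω :=
  {ω | ∃ U : Set Ω, IsOpen U ∧ ω ∈ U ∧
    ∀ x ∈ U, ∀ y ∈ U, ∀ t ≥ (0 : ℝ), dist (σ t x) (σ t y) ≤ ε}

theorem isOpen_forwardStable (ε : ℝ) : IsOpen (forwardStable σ ε) := by
  refine isOpen_iff_forall_mem_open.2 ?_
  rintro ω ⟨U, hU, hω, h⟩
  exact ⟨U, fun z hz => ⟨U, hU, hz, h⟩, hU, hω⟩

theorem continuous_flow_time (hσcont : Continuous fun p : ℝ × Ω => σ p.1 p.2) (t : ℝ) :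
    Continuous (σ t) :=
  hσcont.comp (by fun_prop : Continuous fun ω : Ω => (t, ω))

theorem exists_dist_lt_of_mem_Icc [CompactSpace Ω]
    (hσcont : Continuous fun p : ℝ × Ω => σ p.1 p.2) (T : ℝ) {ε : ℝ} (hε : 0 < ε) :
    ∃ δ > (0 : ℝ), ∀ x y : Ω, dist x y < δ → ∀ s ∈ Icc 0 T, dist (σ s x) (σ s y) < ε := by
  have hc : IsCompact (Icc (0 : ℝ) T ×ˢ (univ : Set Ω)) := isCompact_Icc.prod isCompact_univ
  obtain ⟨δ, hδ, h⟩ := Metric.uniformContinuousOn_iff.1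
    (hc.uniformContinuousOn_of_continuous hσcont.continuousOn) ε hε
  refine ⟨δ, hδ, fun x y hxy s hs => h (s, x) ⟨hs, mem_univ _⟩ (s, y) ⟨hs, mem_univ _⟩ ?_⟩
  simpa [Prod.dist_eq, hδ] using hxy

theorem mem_forwardStable_of_flow_mem [CompactSpace Ω]
    (hσcont : Continuous fun p : ℝ × Ω => σ p.1 p.2)
    (hσadd : ∀ s t ω, σ (s + t) ω = σ s (σ t ω)) {ε : ℝ} (hε : 0 < ε) {τ : ℝ}
    {ω : Ω} (h : σ τ ω ∈ forwardStable σ ε) : ω ∈ forwardStable σ ε := by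
  obtain ⟨U, hU, hω, h⟩ := h
  obtain ⟨δ, hδ, hd⟩ := exists_dist_lt_of_mem_Icc hσcont τ hε
  refine ⟨σ τ ⁻¹' U ∩ Metric.ball ω (δ / 2),
    (hU.preimage (continuous_flow_time hσcont τ)).inter Metric.isOpen_ball,
    ⟨hω, Metric.mem_ball_self (half_pos hδ)⟩, ?_⟩
  rintro x ⟨hxU, hx⟩ y ⟨hyU, hy⟩ t ht
  rcases le_total t τ with htτ | htτ
  · refine (hd x y ?_ t ⟨ht, htτ⟩).le
    have := dist_triangle_right x y ω
    rw [Metric.mem_ball] at hx hy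
    linarith
  · have := h _ hxU _ hyU (t - τ) (by linarith)
    rwa [← hσadd, ← hσadd, sub_add_cancel] at this

/-- If the flow is not sensitive and is topologically transitive, then it has a point of forward
equicontinuity. -/
theorem exists_forall_mem_forwardStable [CompactSpace Ω] [Nonempty Ω]
    (hσcont : Continuous fun p : ℝ × Ω => σ p.1 p.2)
    (hσadd : ∀ s t ω, σ (s + t) ω = σ s (σ t ω))
    (htrans : ∀ U V : Set Ω, IsOpen U → IsOpen V → U.Nonempty → V.Nonempty →
      ∃ t > (0 : ℝ), ((σ t '' U) ∩ V).Nonempty)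
    (hns : ∀ ε > (0 : ℝ), ∃ ω₁ : Ω, ∃ δ > (0 : ℝ), ∀ ω₂ : Ω, dist ω₁ ω₂ ≤ δ →
      ∀ t ≥ (0 : ℝ), dist (σ t ω₁) (σ t ω₂) ≤ ε) :
    ∃ x : Ω, ∀ ε > (0 : ℝ), x ∈ forwardStable σ ε := by
  have hne : ∀ ε > (0 : ℝ), (forwardStable σ ε).Nonempty := by
    intro ε hε
    obtain ⟨ω, δ, hδ, h⟩ := hns (ε / 2) (half_pos hε)
    refine ⟨ω, Metric.ball ω δ, Metric.isOpen_ball, Metric.mem_ball_self hδ, ?_⟩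
    intro x hx y hy t ht
    have h1 := h x (Metric.mem_ball'.1 hx).le t ht
    have h2 := h y (Metric.mem_ball'.1 hy).le t ht
    have := dist_triangle_left (σ t x) (σ t y) (σ t ω)
    linarith
  have hdense : ∀ ε > (0 : ℝ), Dense (forwardStable σ ε) := by
    intro ε hε
    refine dense_iff_inter_open.2 fun V hV hVne => ?_
    obtain ⟨t, -, _, ⟨v, hv, rfl⟩, hz⟩ :=
      htrans V _ hV (isOpen_forwardStable ε) hVne (hne ε hε)
    exact ⟨v, hv, mem_forwardStable_of_flow_mem hσcont hσadd hε hz⟩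
  obtain ⟨x, hx⟩ := (dense_iInter_of_isOpen_nat
    (fun n : ℕ => isOpen_forwardStable (σ := σ) (1 / ((n : ℝ) + 1)))
    (fun n => hdense _ (by positivity))).nonempty
  refine ⟨x, fun ε hε => ?_⟩
  obtain ⟨n, hn⟩ := exists_nat_one_div_lt hε
  obtain ⟨U, hU, hxU, h⟩ := mem_iInter.1 hx n
  exact ⟨U, hU, hxU, fun a ha b hb t ht => (h a ha b hb t ht).trans hn.le⟩

/-- The forward orbit of a point of forward equicontinuity is dense if the flow is topologically
transitive. -/
theorem exists_flow_dist_lt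
    (htrans : ∀ U V : Set Ω, IsOpen U → IsOpen V → U.Nonempty → V.Nonempty →
      ∃ t > (0 : ℝ), ((σ t '' U) ∩ V).Nonempty)
    {x : Ω} (hx : ∀ ε > (0 : ℝ), x ∈ forwardStable σ ε) (z : Ω) {ε : ℝ} (hε : 0 < ε) :
    ∃ t ≥ (0 : ℝ), dist (σ t x) z < ε := by
  obtain ⟨U, hU, hxU, h⟩ := hx (ε / 2) (half_pos hε)
  obtain ⟨t, ht, _, ⟨u, hu, rfl⟩, hz⟩ := htrans U (Metric.ball z (ε / 2)) hU
    Metric.isOpen_ball ⟨x, hxU⟩ ⟨z, Metric.mem_ball_self (half_pos hε)⟩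
  refine ⟨t, ht.le, ?_⟩
  have h1 := h x hxU u hu t ht.le
  have h2 := Metric.mem_ball.1 hz
  have := dist_triangle (σ t x) (σ t u) z
  linarith

variable [MeasurableSpace Ω] [BorelSpace Ω] {m : Measure Ω} [IsProbabilityMeasure m]

/-- If the flow preserves a probability measure of full support, then every forward orbit
comes arbitrarily close to every point of forward equicontinuity having a dense forward orbit. -/
theorem exists_flow_dist_forwardStable_lt [CompactSpace Ω]
    (hσcont : Continuous fun p : ℝ × Ω => σ p.1 p.2)
    (hσadd : ∀ s t ω, σ (s + t) ω = σ s (σ t ω))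
    (hminv : ∀ t, Measure.map (σ t) m = m)
    (hsupp : ∀ U : Set Ω, IsOpen U → U.Nonempty → 0 < m U)
    {x : Ω} (hx : ∀ ε > (0 : ℝ), x ∈ forwardStable σ ε)
    (hdense : ∀ z : Ω, ∀ ε > (0 : ℝ), ∃ t ≥ (0 : ℝ), dist (σ t x) z < ε)
    (z : Ω) {ε : ℝ} (hε : 0 < ε) :
    ∃ t ≥ (0 : ℝ), dist (σ t z) x < ε := by
  by_contra! hz
  obtain ⟨U, hU, hxU, h⟩ := hx (ε / 4) (by positivity)
  set V := U ∩ Metric.ball x (ε / 4)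
  have hV : IsOpen V := hU.inter Metric.isOpen_ball
  have hxV : x ∈ V := ⟨hxU, Metric.mem_ball_self (by positivity)⟩
  obtain ⟨f, -, hf⟩ := exists_seq_of_forall_finset_exists (fun t : ℝ => 0 ≤ t)
    (fun s t => Disjoint (σ s ⁻¹' V) (σ t ⁻¹' V)) (by
      intro S hS
      obtain ⟨T, hT⟩ := S.bddAbove
      obtain ⟨δ, hδ, hd⟩ := exists_dist_lt_of_mem_Icc hσcont T (half_pos hε)
      obtain ⟨τ, hτ, hτz⟩ := hdense z δ hδ
      refine ⟨τ + max T 0, by positivity, fun t ht => ?_⟩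
      have htT : t ≤ T := hT ht
      have ht0 := hS t ht
      rw [max_eq_left (ht0.trans htT)]
      refine disjoint_left.2 fun w hw hw' => ?_
      have e1 : τ + T = (T - t + τ) + t := by ring
      rw [mem_preimage, e1, hσadd] at hw'
      have h1 := hd _ _ hτz (T - t) ⟨by linarith, by linarith⟩
      rw [← hσadd] at h1
      have h2 := hz (T - t) (by linarith)
      have h3 := h x hxU _ hw.1 (T - t + τ) (by linarith)
      have h4 := Metric.mem_ball.1 hw'.2
      have h5 := dist_triangle (σ (T - t) z) (σ (T - t + τ) x) x
      have h6 := dist_triangle (σ (T - t + τ) x) (σ (T - t + τ) (σ t w)) x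
      rw [dist_comm] at h1
      linarith)
  have hmeas : ∀ n, m (σ (f n) ⁻¹' V) = m V := fun n => by
    rw [← Measure.map_apply (continuous_flow_time hσcont _).measurable hV.measurableSet, hminv]
  obtain ⟨i, j, hij, hne⟩ := exists_nonempty_inter_of_measure_univ_lt_tsum_measure m
    (s := fun n => σ (f n) ⁻¹' V)
    (fun n => (hV.preimage (continuous_flow_time hσcont _)).measurableSet.nullMeasurableSet) (by
      simp only [hmeas]
      rw [ENNReal.tsum_const_eq_top_of_ne_zero (hsupp V hV ⟨x, hxV⟩).ne']
      exact measure_lt_top _ _)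
  rcases hij.lt_or_gt with hlt | hlt
  · exact not_disjoint_iff_nonempty_inter.2 hne (hf i j hlt)
  · exact not_disjoint_iff_nonempty_inter.2 hne (hf j i hlt).symm

/-- A forward equicontinuous flow preserving a probability measure of full support is backward
equicontinuous. -/
theorem exists_dist_lt_of_flow_dist_lt [CompactSpace Ω]
    (hσcont : Continuous fun p : ℝ × Ω => σ p.1 p.2)
    (hσ0 : ∀ ω, σ 0 ω = ω)
    (hσadd : ∀ s t ω, σ (s + t) ω = σ s (σ t ω))
    (hminv : ∀ t, Measure.map (σ t) m = m)
    (hsupp : ∀ U : Set Ω, IsOpen U → U.Nonempty → 0 < m U)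
    (heq : ∀ ε > (0 : ℝ), ∃ δ > (0 : ℝ), ∀ x y : Ω, dist x y < δ →
      ∀ t ≥ (0 : ℝ), dist (σ t x) (σ t y) < ε)
    {ε : ℝ} (hε : 0 < ε) :
    ∃ δ > (0 : ℝ), ∀ a b : Ω, ∀ t ≥ (0 : ℝ), dist (σ t a) (σ t b) < δ → dist a b < ε := by
  obtain ⟨δ, hδ, h⟩ := heq (ε / 5) (by positivity)
  refine ⟨δ, hδ, fun a b t ht hab => ?_⟩
  set r := min δ (ε / 5)
  have hr0 : 0 < r := by positivity
  have hrδ : r ≤ δ := min_le_left _ _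
  have hrε : r ≤ ε / 5 := min_le_right _ _
  have hpres : MeasurePreserving (σ (t + 1)) m m :=
    ⟨(continuous_flow_time hσcont _).measurable, hminv _⟩
  have hball : ∀ c : Ω, m (Metric.ball c r) ≠ 0 := fun c =>
    (hsupp _ Metric.isOpen_ball ⟨c, Metric.mem_ball_self hr0⟩).ne'
  obtain ⟨⟨u, v⟩, ⟨hu, hv⟩, n, hn, hmem⟩ := (hpres.prod hpres).exists_mem_iterate_mem
    (s := Metric.ball a r ×ˢ Metric.ball b r)
    (Metric.isOpen_ball.prod Metric.isOpen_ball).measurableSet.nullMeasurableSet (by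
      rw [Measure.prod_prod]
      exact mul_ne_zero (hball a) (hball b))
  rw [Prod.map_iterate, Prod.map_apply, iterate_flow hσ0 hσadd, iterate_flow hσ0 hσadd] at hmem
  obtain ⟨hu', hv'⟩ := hmem
  simp only [Metric.mem_ball] at hu hv hu' hv'
  set s : ℝ := n * (t + 1) with hs
  have hn1 : (1 : ℝ) ≤ n := by exact_mod_cast Nat.one_le_iff_ne_zero.2 hn
  have hst : t ≤ s := by nlinarith
  have h1 := h _ _ (hu.trans_le hrδ) s (ht.trans hst)
  have h2 := h _ _ (hv.trans_le hrδ) s (ht.trans hst)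
  have h3 := h _ _ hab (s - t) (by linarith)
  rw [← hσadd, ← hσadd, sub_add_cancel] at h3
  have h4 := dist_triangle4 a (σ s u) (σ s a) (σ s b)
  have h5 := dist_triangle4 a (σ s b) (σ s v) b
  rw [dist_comm] at hu' h2
  linarith

end Flow

/-- Glasner–Weiss dichotomy: a topologically transitive continuous flow on a
nonempty compact metric space supporting a fully-supported invariant Borel probability
measure is either minimal and equicontinuous, or sensitive with respect to initial
conditions (hence Auslander–Yorke chaotic, being also transitive). -/
theorem stmt11 {Ω : Type*} [MetricSpace Ω] [CompactSpace Ω] [Nonempty Ω]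
    [MeasurableSpace Ω] [BorelSpace Ω]
    (σ : ℝ → Ω → Ω)
    (hσcont : Continuous fun p : ℝ × Ω => σ p.1 p.2)
    (hσ0 : ∀ ω, σ 0 ω = ω)
    (hσadd : ∀ s t ω, σ (s + t) ω = σ s (σ t ω))
    (htrans : ∀ U V : Set Ω, IsOpen U → IsOpen V → U.Nonempty → V.Nonempty →
      ∃ t > (0:ℝ), ((σ t '' U) ∩ V).Nonempty)
    (m : Measure Ω) [IsProbabilityMeasure m]
    (hminv : ∀ t, Measure.map (σ t) m = m)
    (hsupp : ∀ U : Set Ω, IsOpen U → U.Nonempty → 0 < m U) :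
    ((∀ ω : Ω, Dense (Set.range fun t => σ t ω)) ∧
      (∀ ε > (0:ℝ), ∃ δ > (0:ℝ), ∀ ω₁ ω₂ : Ω, dist ω₁ ω₂ < δ →
        ∀ t : ℝ, dist (σ t ω₁) (σ t ω₂) < ε)) ∨
    (∃ ε > (0:ℝ), ∀ ω₁ : Ω, ∀ δ > (0:ℝ), ∃ ω₂ : Ω, dist ω₁ ω₂ ≤ δ ∧
      ∃ t ≥ (0:ℝ), dist (σ t ω₁) (σ t ω₂) > ε) := by
  by_contra! hcon
  obtain ⟨hneg, hns⟩ := hcon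
  obtain ⟨x, hx⟩ := exists_forall_mem_forwardStable hσcont hσadd htrans hns
  have hdense : ∀ z : Ω, ∀ ε > (0 : ℝ), ∃ t ≥ (0 : ℝ), dist (σ t x) z < ε :=
    fun z ε hε => exists_flow_dist_lt htrans hx z hε
  have hreach : ∀ z : Ω, ∀ ε > (0 : ℝ), ∃ t ≥ (0 : ℝ), dist (σ t z) x < ε := fun z ε hε =>
    exists_flow_dist_forwardStable_lt hσcont hσadd hminv hsupp hx hdense z hε
  have hmin : ∀ ω : Ω, Dense (Set.range fun t => σ t ω) := by
    refine fun ω => Metric.dense_iff.2 fun z r hr => ?_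
    obtain ⟨τ, -, hτz⟩ := hdense z r hr
    obtain ⟨δ, hδ, hball⟩ := Metric.isOpen_iff.1
      (Metric.isOpen_ball.preimage (continuous_flow_time hσcont τ)) x (Metric.mem_ball.2 hτz)
    obtain ⟨s, -, hs⟩ := hreach ω δ hδ
    exact ⟨σ (τ + s) ω, by rw [hσadd]; exact hball hs, τ + s, rfl⟩
  have hstable : ∀ ε > (0 : ℝ), ∀ z, z ∈ forwardStable σ ε := by
    intro ε hε z
    obtain ⟨δ, hδ, hball⟩ := Metric.isOpen_iff.1 (isOpen_forwardStable ε) x (hx ε hε)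
    obtain ⟨s, -, hs⟩ := hreach z δ hδ
    exact mem_forwardStable_of_flow_mem hσcont hσadd hε (hball hs)
  have hforward : ∀ ε > (0 : ℝ), ∃ δ > (0 : ℝ), ∀ x y : Ω, dist x y < δ →
      ∀ t ≥ (0 : ℝ), dist (σ t x) (σ t y) < ε := by
    intro ε hε
    choose U hU hmem h using hstable (ε / 2) (half_pos hε)
    obtain ⟨δ, hδ, hleb⟩ := lebesgue_number_lemma_of_metric isCompact_univ hU
      (fun z _ => Set.mem_iUnion.2 ⟨z, hmem z⟩)
    refine ⟨δ, hδ, fun a b hab t ht => ?_⟩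
    obtain ⟨i, hi⟩ := hleb a (Set.mem_univ a)
    have := h i a (hi (Metric.mem_ball_self hδ)) b (hi (Metric.mem_ball'.2 hab)) t ht
    linarith
  obtain ⟨ε, hε, hbad⟩ := hneg hmin
  obtain ⟨δ₁, hδ₁, h₁⟩ := hforward ε hε
  obtain ⟨δ₂, hδ₂, h₂⟩ :=
    exists_dist_lt_of_flow_dist_lt hσcont hσ0 hσadd hminv hsupp hforward hε
  obtain ⟨a, b, hab, t, ht⟩ := hbad (min δ₁ δ₂) (lt_min hδ₁ hδ₂)
  refine ht.not_gt ?_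
  rcases le_total 0 t with h0 | h0
  · exact h₁ a b (hab.trans_le (min_le_left _ _)) t h0
  · refine h₂ _ _ (-t) (by linarith) ?_
    rw [← hσadd, ← hσadd, neg_add_cancel, hσ0, hσ0]
    exact hab.trans_le (min_le_right _ _)
end

section
/- Let σ be a minimal continuous flow on a nonempty compact metric space Ω, let A ⊆ Ω × ℝ be a nonempty compact set, and let τ be a continuous flow on A of skewproduct form τ(t,(ω,x)) = (ω·t, X(t,ω,x)). Let m be a σ-ergodic Borel probability measure on Ω, and let η : Ω → ℝ be a bounded Borel function whose graph is contained in A, which has at least one continuity point, and for which there exists a σ-invariant set Ω_η ⊆ Ω with m(Ω_η) = 1 such that τ(t,(ω,η(ω))) = (ω·t, η(ω·t)) for all ω ∈ Ω_η and t ∈ ℝ. Let μ_η be the pushforward of m under ω ↦ (ω, η(ω)) and let S_η ⊆ A be the topological support of μ_η. Then there exists Ω_* ⊆ Ω_η with m(Ω_*) = 1 such that for every ω̄ ∈ Ω_*: (ω̄, η(ω̄)) ∈ S_η and S_η equals the ω-limit set under τ of (ω̄, η(ω̄)). In particular, S_η is a compact τ-invariant set which is pinched (there exists ω ∈ Ω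 such that S_η ∩ ({ω} × ℝ) is a singleton) and which contains a dense forward τ-semiorbit. -/
open MeasureTheory Filter Topology

/-- Zero-one law for measurable sets that are invariant, modulo null sets, under each time map of a
measurable flow for which every strictly invariant measurable set is trivial. -/
theorem measure_eq_zero_or_one_of_ae_invariant {Ω : Type*} [MeasurableSpace Ω]
    {σ : ℝ → Ω → Ω} (hσ : Measurable fun p : ℝ × Ω => σ p.1 p.2)
    (hσadd : ∀ s t ω, σ (s + t) ω = σ s (σ t ω))
    {m : Measure Ω} [SFinite m]
    (herg : ∀ B : Set Ω, MeasurableSet B → (∀ t, σ t ⁻¹' B = B) → m B = 0 ∨ m B = 1)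
    {V : Set Ω} (hV : MeasurableSet V) (hinv : ∀ t, ∀ᵐ ω ∂m, σ t ω ∈ V ↔ ω ∈ V) :
    m V = 0 ∨ m V = 1 := by
  set B : Set Ω := {ω | ∀ᵐ t ∂(volume : Measure ℝ), σ t ω ∈ V} with hBdef
  have hσswap : Measurable fun p : Ω × ℝ => σ p.2 p.1 := hσ.comp measurable_swap
  have hB : MeasurableSet B :=
    measurable_measure_prodMk_left (ν := (volume : Measure ℝ)) (hσswap hV.compl)
      (measurableSet_singleton 0)
  have hBinv : ∀ s, σ s ⁻¹' B = B := by
    intro s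
    ext ω
    simp only [hBdef, Set.mem_preimage, Set.mem_ofPred_eq, ← hσadd]
    exact eventually_add_right_iff volume s (p := fun t => σ t ω ∈ V)
  have hmeas : MeasurableSet {p : Ω × ℝ | σ p.2 p.1 ∈ V ↔ p.1 ∈ V} :=
    (hσswap hV).iff (measurable_fst hV)
  have hae : ∀ᵐ ω ∂m, ∀ᵐ t ∂(volume : Measure ℝ), σ t ω ∈ V ↔ ω ∈ V :=
    (Measure.ae_ae_comm (p := fun ω t => σ t ω ∈ V ↔ ω ∈ V) hmeas).2 (ae_of_all _ hinv)
  have hBV : B =ᵐ[m] V := by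
    refine eventuallyEq_set.2 ?_
    filter_upwards [hae] with ω hω
    constructor
    · intro h
      obtain ⟨t, ht, htV⟩ := (Eventually.and (show ∀ᵐ t, σ t ω ∈ V from h) hω).exists
      exact htV.1 ht
    · intro h
      filter_upwards [hω] with t ht using ht.2 h
  rw [← measure_congr hBV]
  exact herg B hB hBinv

section Visits

variable {X : Type*} {τ : ℝ → X → X}

/-- The set of points whose orbit meets `U` at arbitrarily large times is invariant. -/
theorem frequently_flow_mem_iff (hτadd : ∀ s t p, τ (s + t) p = τ s (τ t p)) (U : Set X) (s : ℝ)
    (p : X) : (∃ᶠ t in atTop, τ t (τ s p) ∈ U) ↔ ∃ᶠ t in atTop, τ t p ∈ U := by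
  constructor
  · intro h
    refine (tendsto_atTop_add_const_right atTop s tendsto_id).frequently (p := fun t => τ t p ∈ U) ?_
    simpa [hτadd] using h
  · intro h
    refine (tendsto_atTop_add_const_right atTop (-s) tendsto_id).frequently
      (p := fun t => τ t (τ s p) ∈ U) ?_
    simpa [← hτadd] using h

/-- The set of points whose orbit meets an open set at arbitrarily large times is Borel. -/
theorem measurableSet_frequently_flow_mem [TopologicalSpace X] [MeasurableSpace X]
    [OpensMeasurableSpace X] (hτ : ∀ t, Continuous (τ t)) {U : Set X} (hU : IsOpen U) :
    MeasurableSet {p | ∃ᶠ t in atTop, τ t p ∈ U} := by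
  have h : {p | ∃ᶠ t in atTop, τ t p ∈ U} = ⋂ n : ℕ, ⋃ t ≥ (n : ℝ), τ t ⁻¹' U := by
    ext p
    simp only [Set.mem_ofPred_eq, frequently_atTop, Set.mem_iInter, Set.mem_iUnion, Set.mem_preimage,
      exists_prop]
    refine ⟨fun h n => h n, fun h a => ?_⟩
    obtain ⟨n, hn⟩ := exists_nat_ge a
    obtain ⟨t, ht, htU⟩ := h n
    exact ⟨t, hn.trans ht, htU⟩
  rw [h]
  exact .iInter fun n =>
    (isOpen_iUnion fun t => isOpen_iUnion fun _ => hU.preimage (hτ t)).measurableSet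

/-- Poincaré recurrence for flows: almost every point of `U` returns to `U` at arbitrarily large
times. -/
theorem measure_le_measure_frequently_flow_mem [MeasurableSpace X] (hτ0 : ∀ p, τ 0 p = p)
    (hτadd : ∀ s t p, τ (s + t) p = τ s (τ t p)) {μ : Measure X} [IsFiniteMeasure μ]
    (hμ : MeasurePreserving (τ 1) μ μ) {U : Set X} (hU : MeasurableSet U) :
    μ U ≤ μ {p | ∃ᶠ t in atTop, τ t p ∈ U} := by
  refine measure_mono_ae ?_
  filter_upwards [hμ.conservative.ae_mem_imp_frequently_image_mem hU.nullMeasurableSet] with p hp hpU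
  have hiter : ∀ n : ℕ, (τ 1)^[n] p = τ n p := by
    intro n
    induction n with
    | zero => simp [hτ0]
    | succ k ih => rw [Function.iterate_succ_apply', ih, ← hτadd, Nat.cast_succ, add_comm]
  refine tendsto_natCast_atTop_atTop.frequently (p := fun t : ℝ => τ t p ∈ U) ?_
  simpa [hiter] using hp hpU

/-- If every time map preserves `μ`, then the support of `μ` is invariant. -/
theorem flow_mem_measureSupport [TopologicalSpace X] [MeasurableSpace X] [OpensMeasurableSpace X]
    (hτ : ∀ t, Continuous (τ t)) {μ : Measure X}
    (hμ : ∀ t, MeasurePreserving (τ t) μ μ) {p : X} (hp : p ∈ μ.support) (t : ℝ) :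
    τ t p ∈ μ.support := by
  rw [Measure.support_eq_forall_isOpen] at hp ⊢
  intro U hpU hU
  rw [← (hμ t).measure_preimage hU.measurableSet.nullMeasurableSet]
  exact hp _ hpU (hU.preimage (hτ t))

/-- In a first countable space, a point is a sequential limit along times going to `∞` if and only
if all its neighbourhoods are visited at arbitrarily large times. -/
theorem exists_seq_tendsto_iff_forall_frequently [TopologicalSpace X] [FirstCountableTopology X]
    (u : ℝ → X) (q : X) :
    (∃ tn : ℕ → ℝ, Tendsto tn atTop atTop ∧ Tendsto (fun n => u (tn n)) atTop (𝓝 q)) ↔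
      ∀ U, IsOpen U → q ∈ U → ∃ᶠ t in atTop, u t ∈ U := by
  constructor
  · rintro ⟨tn, htn, hlim⟩ U hU hq
    exact htn.frequently (hlim.eventually (hU.mem_nhds hq)).frequently
  · intro h
    obtain ⟨s, hs, hsb⟩ := (nhds_basis_opens q).exists_antitone_subbasis
    choose tn htn hmem using fun n : ℕ => frequently_atTop.1 (h (s n) (hs n).2 (hs n).1) (n : ℝ)
    exact ⟨tn, tendsto_atTop_mono htn tendsto_natCast_atTop_atTop, hsb.tendsto hmem⟩

end Visits

/-- If a function is continuous at `a` and `(a, y)` is a limit of points of its graph,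
then `y` is the value at `a`. -/
theorem ContinuousAt.eq_of_mem_closure_graph {X Y : Type*} [TopologicalSpace X] [TopologicalSpace Y]
    [T2Space Y] {f : X → Y} {a : X} (hf : ContinuousAt f a) {y : Y}
    (h : (a, y) ∈ closure (Set.range fun x => (x, f x))) : y = f a := by
  by_contra hne
  obtain ⟨v, w, hv, hw, hyv, hfw, hvw⟩ := t2_separation hne
  have hnhds : (f ⁻¹' w) ×ˢ v ∈ 𝓝 (a, y) :=
    prod_mem_nhds (hf (hw.mem_nhds hfw)) (hv.mem_nhds hyv)
  obtain ⟨_, ⟨hxw, hxv⟩, x, rfl⟩ := mem_closure_iff_nhds.1 h _ hnhds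
  exact Set.disjoint_left.1 hvw hxv hxw

/-- In the setting of a skewproduct flow `τ` on a nonempty compact
`A ⊆ Ω × ℝ` over a minimal flow, with `m` a `σ`-ergodic measure and `η` a bounded Borel
equilibrium (on a full-measure invariant set) having a continuity point, the support
`S_η` of the pushforward measure `μ_η` equals the omega-limit set of `(ω̄, η(ω̄))` for
every `ω̄` in a full-measure set `Ω_* ⊆ Ω_η`; in particular `S_η` is a compact
`τ`-invariant pinched set containing a dense forward semiorbit. -/
theorem stmt13 {Ω : Type*} [MetricSpace Ω] [CompactSpace Ω] [Nonempty Ω]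
    [MeasurableSpace Ω] [BorelSpace Ω]
    (σ : ℝ → Ω → Ω)
    (hσcont : Continuous fun p : ℝ × Ω => σ p.1 p.2)
    (hσ0 : ∀ ω, σ 0 ω = ω)
    (hσadd : ∀ s t ω, σ (s + t) ω = σ s (σ t ω))
    (hmin : ∀ ω : Ω, Dense (Set.range fun t => σ t ω))
    (A : Set (Ω × ℝ)) (hAne : A.Nonempty) (hAcomp : IsCompact A)
    (τ : ℝ → A → A)
    (hτcont : Continuous fun p : ℝ × A => τ p.1 p.2)
    (hτ0 : ∀ p : A, τ 0 p = p)
    (hτadd : ∀ s t : ℝ, ∀ p : A, τ (s + t) p = τ s (τ t p))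
    (hskew : ∀ t : ℝ, ∀ p : A, (τ t p).1.1 = σ t p.1.1)
    (m : Measure Ω) [IsProbabilityMeasure m]
    (hminv : ∀ t, Measure.map (σ t) m = m)
    (herg : ∀ B : Set Ω, MeasurableSet B → (∀ t, σ t ⁻¹' B = B) → m B = 0 ∨ m B = 1)
    (η : Ω → ℝ) (hηmeas : Measurable η) (hηbdd : ∃ C : ℝ, ∀ ω, |η ω| ≤ C)
    (hgraph : ∀ ω : Ω, (ω, η ω) ∈ A)
    (ωc : Ω) (hηcont : ContinuousAt η ωc)
    (Ωη : Set Ω) (hΩηinv : ∀ ω ∈ Ωη, ∀ t : ℝ, σ t ω ∈ Ωη) (hΩηfull : m Ωη = 1)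
    (hηeq : ∀ ω ∈ Ωη, ∀ t : ℝ,
      (τ t ⟨(ω, η ω), hgraph ω⟩).1 = (σ t ω, η (σ t ω)))
    (μη : Measure A)
    (hμη : μη = Measure.map (fun ω : Ω => (⟨(ω, η ω), hgraph ω⟩ : A)) m)
    (Sη : Set A)
    (hSη : Sη = {p : A | ∀ U : Set A, IsOpen U → p ∈ U → 0 < μη U}) :
    (∃ Ωstar : Set Ω, Ωstar ⊆ Ωη ∧ m Ωstar = 1 ∧
      ∀ ωb ∈ Ωstar,
        (⟨(ωb, η ωb), hgraph ωb⟩ : A) ∈ Sη ∧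
        Sη = {q : A | ∃ tn : ℕ → ℝ, Tendsto tn atTop atTop ∧
          Tendsto (fun n => τ (tn n) ⟨(ωb, η ωb), hgraph ωb⟩) atTop (𝓝 q)}) ∧
    IsCompact Sη ∧
    (∀ t : ℝ, τ t '' Sη = Sη) ∧
    (∃ ω : Ω, ∃ x : ℝ, (∃ p ∈ Sη, (p : Ω × ℝ) = (ω, x)) ∧
      ∀ p ∈ Sη, (p : Ω × ℝ).1 = ω → (p : Ω × ℝ).2 = x) ∧
    (∃ p ∈ Sη, Sη ⊆ closure {q : A | ∃ t ≥ (0:ℝ), q = τ t p}) := by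
  have : CompactSpace A := isCompact_iff_compactSpace.1 hAcomp
  set g : Ω → A := fun ω => ⟨(ω, η ω), hgraph ω⟩
  have hgm : Measurable g := (measurable_id.prodMk hηmeas).subtype_mk
  have hσt : ∀ t, Measurable (σ t) := fun t =>
    (hσcont.comp (Continuous.prodMk_right t)).measurable
  have hτt : ∀ t, Continuous (τ t) := fun t => hτcont.comp (Continuous.prodMk_right t)
  have hequiv : ∀ t, ∀ᵐ ω ∂m, τ t (g ω) = g (σ t ω) := by
    intro t
    have hE : MeasurableSet {ω | τ t (g ω) = g (σ t ω)} :=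
      measurableSet_eq_fun ((hτt t).measurable.comp hgm) (hgm.comp (hσt t))
    refine (mem_ae_iff_prob_eq_one hE).2 (le_antisymm prob_le_one ?_)
    rw [← hΩηfull]
    exact measure_mono fun ω hω => Subtype.ext (hηeq ω hω t)
  have : IsProbabilityMeasure μη := hμη ▸ Measure.isProbabilityMeasure_map hgm.aemeasurable
  have hpres : ∀ t, MeasurePreserving (τ t) μη μη := by
    intro t
    refine ⟨(hτt t).measurable, ?_⟩
    rw [hμη, Measure.map_map (hτt t).measurable hgm]
    calc Measure.map (τ t ∘ g) m = Measure.map (g ∘ σ t) m := Measure.map_congr (hequiv t)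
      _ = Measure.map g m := by rw [← Measure.map_map hgm (hσt t), hminv t]
  have hS : Sη = μη.support := by
    rw [hSη, Measure.support_eq_forall_isOpen]
    ext p
    exact forall_congr' fun U => ⟨fun h a b => h b a, fun h a b => h b a⟩
  have hSclosed : IsClosed Sη := hS ▸ Measure.isClosed_support
  have hSinv : ∀ t, ∀ p ∈ Sη, τ t p ∈ Sη := fun t p hp => by
    rw [hS] at hp ⊢
    exact flow_mem_measureSupport hτt hpres hp t
  have hvisit : ∀ U : Set A, IsOpen U → 0 < μη U → ∀ᵐ ω ∂m, ∃ᶠ t in atTop, τ t (g ω) ∈ U := by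
    intro U hU hpos
    have hF := measurableSet_frequently_flow_mem hτt hU
    have hle := measure_le_measure_frequently_flow_mem hτ0 hτadd (hpres 1) hU.measurableSet
    have hFm : μη {p | ∃ᶠ t in atTop, τ t p ∈ U} = m {ω | ∃ᶠ t in atTop, τ t (g ω) ∈ U} := by
      rw [hμη, Measure.map_apply hgm hF]
      rfl
    have hV : MeasurableSet {ω | ∃ᶠ t in atTop, τ t (g ω) ∈ U} := hgm hF
    refine (mem_ae_iff_prob_eq_one hV).2 ?_
    refine (measure_eq_zero_or_one_of_ae_invariant hσcont.measurable hσadd herg hV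
      fun t => ?_).resolve_left (hFm ▸ (hpos.trans_le hle).ne')
    filter_upwards [hequiv t] with ω hω
    rw [← hω]
    exact frequently_flow_mem_iff hτadd U t (g ω)
  have hsupp : ∀ᵐ ω ∂m, g ω ∈ Sη := by
    have h : ∀ᵐ p ∂μη, p ∈ Sη := hS ▸ Measure.support_mem_ae
    rw [hμη] at h
    exact ae_of_ae_map hgm.aemeasurable h
  have hbasis : ∀ᵐ ω ∂m, ∀ U ∈ TopologicalSpace.countableBasis A, 0 < μη U →
      ∃ᶠ t in atTop, τ t (g ω) ∈ U := by
    refine (ae_ball_iff (TopologicalSpace.countable_countableBasis A)).2 fun U hU => ?_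
    by_cases hpos : 0 < μη U
    · filter_upwards [hvisit U (TopologicalSpace.isOpen_of_mem_countableBasis hU) hpos] with ω hω _
        using hω
    · exact ae_of_all _ fun ω h => absurd h hpos
  have homega : ∀ᵐ ω ∂m, g ω ∈ Sη ∧ Sη = {q : A | ∃ tn : ℕ → ℝ, Tendsto tn atTop atTop ∧
      Tendsto (fun n => τ (tn n) (g ω)) atTop (𝓝 q)} := by
    filter_upwards [hsupp, hbasis] with ω hω hωU
    refine ⟨hω, Set.Subset.antisymm (fun q hq => ?_) ?_⟩
    · refine (exists_seq_tendsto_iff_forall_frequently (fun t => τ t (g ω)) q).2 fun U hU hqU => ?_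
      obtain ⟨W, hW, hqW, hWU⟩ :=
        (TopologicalSpace.isBasis_countableBasis A).exists_subset_of_mem_open hqU hU
      rw [hSη] at hq
      have hpos := hq W (TopologicalSpace.isOpen_of_mem_countableBasis hW) hqW
      exact (hωU W hW hpos).mono fun t ht => hWU ht
    · rintro q ⟨tn, -, hlim⟩
      exact hSclosed.mem_of_tendsto hlim (Eventually.of_forall fun n => hSinv _ _ hω)
  have hunique : ∀ p ∈ Sη, (p : Ω × ℝ).1 = ωc → (p : Ω × ℝ).2 = η ωc := by
    rintro p hp rfl
    refine hηcont.eq_of_mem_closure_graph (mem_closure_iff.2 fun U hU hpU => ?_)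
    rw [hSη] at hp
    have hpos := hp (Subtype.val ⁻¹' U) (hU.preimage continuous_subtype_val) hpU
    rw [hμη, Measure.map_apply hgm (hU.preimage continuous_subtype_val).measurableSet] at hpos
    obtain ⟨ω, hω⟩ := nonempty_of_measure_ne_zero hpos.ne'
    exact ⟨_, hω, ω, rfl⟩
  obtain ⟨ω₀, hω₀S, hω₀⟩ := homega.exists
  refine ⟨⟨Ωη ∩ {ω | g ω ∈ Sη ∧ Sη = {q : A | ∃ tn : ℕ → ℝ, Tendsto tn atTop atTop ∧
      Tendsto (fun n => τ (tn n) (g ω)) atTop (𝓝 q)}}, Set.inter_subset_left, ?_, fun ω hω => hω.2⟩,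
    hSclosed.isCompact, fun t => ?_, ⟨ωc, η ωc, ?_, ?_⟩, ⟨g ω₀, hω₀S, ?_⟩⟩
  · rw [← hΩηfull]
    refine measure_congr (eventuallyEq_set.2 ?_)
    filter_upwards [homega] with ω hω using ⟨fun h => h.1, fun h => ⟨h, hω⟩⟩
  · refine Set.Subset.antisymm (Set.image_subset_iff.2 (hSinv t)) fun p hp => ?_
    exact ⟨τ (-t) p, hSinv _ _ hp, by rw [← hτadd, add_neg_cancel, hτ0]⟩
  · have hproj : IsClosed ((fun p : A => (p : Ω × ℝ).1) '' Sη) :=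
      (hSclosed.isCompact.image (continuous_fst.comp continuous_subtype_val)).isClosed
    have horbit : Set.range (fun t => σ t ω₀) ⊆ (fun p : A => (p : Ω × ℝ).1) '' Sη := by
      rintro _ ⟨t, rfl⟩
      exact ⟨τ t (g ω₀), hSinv t _ hω₀S, hskew t _⟩
    obtain ⟨p, hp, hpc⟩ := hproj.closure_subset_iff.2 horbit (hmin ω₀ ωc)
    exact ⟨p, hp, Prod.ext hpc (hunique p hp hpc)⟩
  · exact hunique
  · intro q hq
    rw [hω₀] at hq
    obtain ⟨tn, htn, hlim⟩ := hq
    refine mem_closure_of_tendsto hlim ?_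
    filter_upwards [htn.eventually_ge_atTop 0] with n hn using ⟨tn n, hn, rfl⟩
end

section
/- Let σ be a minimal continuous flow on a nonempty compact metric space Ω. Let α, β : Ω → ℝ be bounded functions with α lower semicontinuous, β upper semicontinuous, and α ≤ β; set A := ⋃_{ω∈Ω} {ω} × [α(ω), β(ω)]. Let τ be a continuous flow on A of skewproduct form τ(t,(ω,x)) = (ω·t, X(t,ω,x)) such that the graphs of α and β are τ-invariant: τ(t,(ω,α(ω))) = (ω·t, α(ω·t)) and τ(t,(ω,β(ω))) = (ω·t, β(ω·t)) for all ω, t. Then: (1) if α(ω̄) = β(ω̄) for some ω̄ ∈ Ω, then both α and β are continuous at ω̄ (so A is pinched if and only if α and β coincide at some common continuity point); (2) if α(ω̄) = β(ω̄) for some ω̄ ∈ Ω, then the set of points at which both α and β are continuous coincides with {ω ∈ Ω : α(ω) = β(ω)}. -/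
open MeasureTheory Topology

/-- The band `A = ⋃_ω {ω} × [α(ω), β(ω)]`, as a subtype of `Ω × ℝ`. -/
abbrev Band {Ω : Type*} (α β : Ω → ℝ) : Type _ :=
  {p : Ω × ℝ // α p.1 ≤ p.2 ∧ p.2 ≤ β p.1}

/-- A lower semicontinuous function and an upper semicontinuous function above it are both
continuous at every point where they coincide. -/
theorem continuousAt_of_semicontinuous_of_eq {X : Type*} [TopologicalSpace X] {f g : X → ℝ}
    (hf : LowerSemicontinuous f) (hg : UpperSemicontinuous g) (hfg : ∀ x, f x ≤ g x)
    {x : X} (hx : f x = g x) : ContinuousAt f x ∧ ContinuousAt g x := by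
  constructor
  · refine tendsto_order.2 ⟨fun a ha => hf x a ha, fun a ha => ?_⟩
    filter_upwards [hg x a (hx.symm.trans_lt ha)] with y hy using (hfg y).trans_lt hy
  · refine tendsto_order.2 ⟨fun a ha => ?_, fun a ha => hg x a ha⟩
    filter_upwards [hf x a (ha.trans_eq hx.symm)] with y hy using hy.trans_le (hfg y)

/-- Two real functions that coincide on a dense set coincide at every common continuity point. -/
theorem eq_of_continuousAt_of_dense {X : Type*} [TopologicalSpace X] {f g : X → ℝ} {s : Set X}
    (hs : Dense s) (hfg : ∀ x ∈ s, f x = g x) {x : X} (hf : ContinuousAt f x)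
    (hg : ContinuousAt g x) : f x = g x := by
  by_contra hne
  have hev : ∀ᶠ y in 𝓝 x, f y - g y ≠ 0 := (hf.sub hg).eventually_ne (sub_ne_zero.2 hne)
  obtain ⟨y, hys, hy⟩ := hs.inter_nhds_nonempty hev
  exact hy (sub_eq_zero.2 (hfg y hys))

/-- For a skewproduct flow on the band between a lower semicontinuous `α`
and an upper semicontinuous `β` with `τ`-invariant graphs, over a minimal base: (1) if
`α(ω̄) = β(ω̄)` at some point, then both `α` and `β` are continuous at that point; (2) if
`α` and `β` coincide somewhere, then the set of common continuity points of `α` and `β`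
is exactly the coincidence set `{ω : α(ω) = β(ω)}`. -/
theorem stmt15 {Ω : Type*} [MetricSpace Ω] [CompactSpace Ω] [Nonempty Ω]
    (σ : ℝ → Ω → Ω)
    (hσcont : Continuous fun p : ℝ × Ω => σ p.1 p.2)
    (hσ0 : ∀ ω, σ 0 ω = ω)
    (hσadd : ∀ s t ω, σ (s + t) ω = σ s (σ t ω))
    (hmin : ∀ ω : Ω, Dense (Set.range fun t => σ t ω))
    (α β : Ω → ℝ)
    (hbdd : ∃ C : ℝ, ∀ ω, |α ω| ≤ C ∧ |β ω| ≤ C)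
    (hα : LowerSemicontinuous α) (hβ : UpperSemicontinuous β)
    (hαβ : ∀ ω, α ω ≤ β ω)
    (τ : ℝ → Band α β → Band α β)
    (hτcont : Continuous fun p : ℝ × Band α β => τ p.1 p.2)
    (hτ0 : ∀ p, τ 0 p = p)
    (hτadd : ∀ s t : ℝ, ∀ p, τ (s + t) p = τ s (τ t p))
    (hskew : ∀ t : ℝ, ∀ p : Band α β, (τ t p).1.1 = σ t p.1.1)
    (hinvα : ∀ (ω : Ω) (t : ℝ),
      (τ t ⟨(ω, α ω), ⟨le_rfl, hαβ ω⟩⟩).1 = (σ t ω, α (σ t ω)))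
    (hinvβ : ∀ (ω : Ω) (t : ℝ),
      (τ t ⟨(ω, β ω), ⟨hαβ ω, le_rfl⟩⟩).1 = (σ t ω, β (σ t ω))) :
    (∀ ωb : Ω, α ωb = β ωb → ContinuousAt α ωb ∧ ContinuousAt β ωb) ∧
    ((∃ ωb : Ω, α ωb = β ωb) →
      {ω : Ω | ContinuousAt α ω ∧ ContinuousAt β ω} = {ω : Ω | α ω = β ω}) := by
  have hcont : ∀ ω : Ω, α ω = β ω → ContinuousAt α ω ∧ ContinuousAt β ω :=
    fun _ h => continuousAt_of_semicontinuous_of_eq hα hβ hαβ h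
  refine ⟨hcont, ?_⟩
  rintro ⟨ωb, hωb⟩
  refine Set.Subset.antisymm ?_ hcont
  rintro ω ⟨hαω, hβω⟩
  refine eq_of_continuousAt_of_dense (hmin ωb) ?_ hαω hβω
  rintro _ ⟨t, rfl⟩
  have hp : (⟨(ωb, α ωb), ⟨le_rfl, hαβ ωb⟩⟩ : Band α β) =
      ⟨(ωb, β ωb), ⟨hαβ ωb, le_rfl⟩⟩ := Subtype.ext (Prod.ext rfl hωb)
  have h := hinvα ωb t
  rw [hp, hinvβ ωb t] at h
  exact (congrArg Prod.snd h).symm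
end

section
/- Let σ be a minimal continuous flow on a nonempty compact metric space Ω, and let Φ : [0,∞) × (Ω × ℝ) → Ω × ℝ be a continuous semiflow of skewproduct form Φ(t,(ω,x)) = (ω·t, X(t,ω,x)) (Φ(0,·) = id and Φ(s+t,·) = Φ(s,·) ∘ Φ(t,·) for s,t ≥ 0). Assume that every forward semiorbit {Φ(t,(ω,x)) : t ≥ 0} is bounded, and that every Φ-minimal set M is a copy of the base, M = {(ω, η_M(ω)) : ω ∈ Ω} for a continuous η_M : Ω → ℝ, which is uniformly exponentially stable at +∞: there exist δ > 0, κ ≥ 1, γ > 0 such that |x₀ − η_M(ω)| ≤ δ implies |X(t,ω,x₀) − η_M(ω·t)| ≤ κ e^{−γt} |x₀ − η_M(ω)| for all t ≥ 0. Then there exists exactly one Φ-minimal set. -/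
open MeasureTheory Topology

/-- A nonempty compact set, invariant for the semiflow `Φ` at all nonnegative times, with
no proper nonempty compact invariant subset. -/
def IsMinimalSemiflowSet {X : Type*} [TopologicalSpace X] (Φ : ℝ → X → X) (M : Set X) :
    Prop :=
  M.Nonempty ∧ IsCompact M ∧ (∀ t ≥ (0:ℝ), Φ t '' M = M) ∧
    ∀ M' : Set X, M' ⊆ M → M'.Nonempty → IsCompact M' →
      (∀ t ≥ (0:ℝ), Φ t '' M' = M') → M' = M

/-- A nonempty compact set that is forward invariant under a semiflow contains a minimal set. -/
theorem exists_isMinimalSemiflowSet_subset {X : Type*} [TopologicalSpace X] [T2Space X]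
    {Φ : ℝ → X → X} (hcont : ∀ t ≥ (0:ℝ), Continuous (Φ t))
    (hadd : ∀ s ≥ (0:ℝ), ∀ t ≥ (0:ℝ), ∀ p, Φ (s + t) p = Φ s (Φ t p))
    {K : Set X} (hne : K.Nonempty) (hK : IsCompact K)
    (hinv : ∀ t ≥ (0:ℝ), Set.MapsTo (Φ t) K K) :
    ∃ M ⊆ K, IsMinimalSemiflowSet Φ M := by
  let S : Set (Set X) :=
    {N | N.Nonempty ∧ IsCompact N ∧ ∀ t ≥ (0:ℝ), Set.MapsTo (Φ t) N N}
  obtain ⟨M, hMK, hM⟩ := zorn_superset_nonempty S (by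
    intro c hcS hc hcne
    have : Nonempty c := hcne.to_subtype
    refine ⟨⋂₀ c, ⟨?_, ?_, ?_⟩, fun s hs => Set.sInter_subset_of_mem hs⟩
    · refine IsCompact.nonempty_sInter_of_directed_nonempty_isCompact_isClosed
        (IsChain.directedOn (r := fun s t : Set X => s ⊇ t) hc.symm) (fun s hs => (hcS hs).1)
        (fun s hs => (hcS hs).2.1) (fun s hs => (hcS hs).2.1.isClosed)
    · obtain ⟨s, hs⟩ := hcne
      exact (hcS hs).2.1.of_isClosed_subset
        (isClosed_sInter fun u hu => (hcS hu).2.1.isClosed) (Set.sInter_subset_of_mem hs)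
    · intro t ht x hx s hs
      exact (hcS hs).2.2 t ht (hx s hs)) K ⟨hne, hK, hinv⟩
  refine ⟨M, hMK, hM.prop.1, hM.prop.2.1, fun t ht => ?_, fun M' hM' hne' hc' hi' => ?_⟩
  · have hmaps := hM.prop.2.2
    refine (hmaps t ht).image_subset.antisymm (hM.le_of_le ⟨hM.prop.1.image _,
      hM.prop.2.1.image (hcont t ht), ?_⟩ (hmaps t ht).image_subset)
    rintro s hs _ ⟨x, hx, rfl⟩
    exact ⟨Φ s x, hmaps s hs hx, by rw [← hadd t ht s hs, ← hadd s hs t ht, add_comm]⟩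
  · exact hM'.antisymm (hM.le_of_le
      ⟨hne', hc', fun t ht x hx => hi' t ht ▸ Set.mem_image_of_mem _ hx⟩ hM')

/-- Two minimal sets of a semiflow that share a point are equal. -/
theorem IsMinimalSemiflowSet.eq_of_mem {X : Type*} [TopologicalSpace X] [T2Space X]
    {Φ : ℝ → X → X} (hcont : ∀ t ≥ (0:ℝ), Continuous (Φ t))
    (hadd : ∀ s ≥ (0:ℝ), ∀ t ≥ (0:ℝ), ∀ p, Φ (s + t) p = Φ s (Φ t p))
    {M N : Set X} (hM : IsMinimalSemiflowSet Φ M) (hN : IsMinimalSemiflowSet Φ N)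
    {p : X} (hpM : p ∈ M) (hpN : p ∈ N) : M = N := by
  obtain ⟨L, hL, hLmin⟩ := exists_isMinimalSemiflowSet_subset hcont hadd
    (K := M ∩ N) ⟨p, hpM, hpN⟩ (hM.2.1.inter hN.2.1) fun t ht x hx =>
      ⟨hM.2.2.1 t ht ▸ Set.mem_image_of_mem _ hx.1,
        hN.2.2.1 t ht ▸ Set.mem_image_of_mem _ hx.2⟩
  rw [← hM.2.2.2 L (hL.trans Set.inter_subset_left) hLmin.1 hLmin.2.1 hLmin.2.2.1,
    ← hN.2.2.2 L (hL.trans Set.inter_subset_right) hLmin.1 hLmin.2.1 hLmin.2.2.1]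

/-- If every forward semiorbit is bounded in the fibre direction, its closure contains a minimal
set. -/
theorem exists_isMinimalSemiflowSet_subset_closure_orbit {Ω : Type*} [MetricSpace Ω]
    [CompactSpace Ω] {Φ : ℝ → Ω × ℝ → Ω × ℝ} (hcont : ∀ t ≥ (0:ℝ), Continuous (Φ t))
    (hadd : ∀ s ≥ (0:ℝ), ∀ t ≥ (0:ℝ), ∀ p, Φ (s + t) p = Φ s (Φ t p))
    {p : Ω × ℝ} (hbdd : ∃ C : ℝ, ∀ t ≥ (0:ℝ), |(Φ t p).2| ≤ C) :
    ∃ M ⊆ closure ((fun t => Φ t p) '' Set.Ici 0), IsMinimalSemiflowSet Φ M := by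
  obtain ⟨C, hC⟩ := hbdd
  refine exists_isMinimalSemiflowSet_subset hcont hadd
    ((Set.nonempty_Ici.image _).closure) ?_ ?_
  · refine (isCompact_univ.prod (isCompact_Icc (a := -C) (b := C))).closure_of_subset ?_
    rintro _ ⟨t, ht, rfl⟩
    exact ⟨Set.mem_univ _, abs_le.1 (hC t ht)⟩
  · intro t ht
    refine Set.MapsTo.closure ?_ (hcont t ht)
    rintro _ ⟨s, hs, rfl⟩
    exact ⟨t + s, add_nonneg ht hs, hadd t ht s hs p⟩

/-- For a skewproduct semiflow over a minimal base with bounded forward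
semiorbits, if every minimal set is a uniformly exponentially stable (at `+∞`) copy of the
base, then there is exactly one minimal set. -/
theorem stmt16 {Ω : Type*} [MetricSpace Ω] [CompactSpace Ω] [Nonempty Ω]
    (σ : ℝ → Ω → Ω)
    (hσcont : Continuous fun p : ℝ × Ω => σ p.1 p.2)
    (hσ0 : ∀ ω, σ 0 ω = ω)
    (hσadd : ∀ s t ω, σ (s + t) ω = σ s (σ t ω))
    (hmin : ∀ ω : Ω, Dense (Set.range fun t => σ t ω))
    (Φ : ℝ → (Ω × ℝ) → (Ω × ℝ))
    (hΦcont : ContinuousOn (fun p : ℝ × (Ω × ℝ) => Φ p.1 p.2)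
      (Set.Ici (0:ℝ) ×ˢ Set.univ))
    (hΦ0 : ∀ p, Φ 0 p = p)
    (hΦadd : ∀ s ≥ (0:ℝ), ∀ t ≥ (0:ℝ), ∀ p, Φ (s + t) p = Φ s (Φ t p))
    (hskew : ∀ t ≥ (0:ℝ), ∀ p : Ω × ℝ, (Φ t p).1 = σ t p.1)
    (hbddorb : ∀ p : Ω × ℝ, ∃ C : ℝ, ∀ t ≥ (0:ℝ), |(Φ t p).2| ≤ C)
    (hstable : ∀ M : Set (Ω × ℝ), IsMinimalSemiflowSet Φ M →
      ∃ η : Ω → ℝ, Continuous η ∧ M = Set.range (fun ω : Ω => (ω, η ω)) ∧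
        ∃ δ > (0:ℝ), ∃ κ ≥ (1:ℝ), ∃ γ > (0:ℝ), ∀ (ω : Ω) (x₀ : ℝ),
          |x₀ - η ω| ≤ δ → ∀ t ≥ (0:ℝ),
            |(Φ t (ω, x₀)).2 - η (σ t ω)| ≤ κ * Real.exp (-γ * t) * |x₀ - η ω|) :
    ∃! M : Set (Ω × ℝ), IsMinimalSemiflowSet Φ M := by
  have hcont : ∀ t ≥ (0:ℝ), Continuous (Φ t) := fun t ht =>
    hΦcont.comp_continuous (f := fun p => (t, p)) (by fun_prop) fun p => ⟨ht, Set.mem_univ p⟩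
  choose! η hη hgraph δ hδ κ hκ γ hγ hst using hstable
  obtain ⟨ω⟩ := ‹Nonempty Ω›
  have hσt : ∀ t, Continuous (σ t) := fun t => hσcont.comp (by fun_prop : Continuous (t, ·))
  let near (M : Set (Ω × ℝ)) (p : Ω × ℝ) : Prop := |p.2 - η M p.1| < δ M
  have hnear : ∀ M, IsMinimalSemiflowSet Φ M → IsOpen {p | near M p} := fun M hM => by
    have := hη M hM
    exact isOpen_lt (by fun_prop) continuous_const
  have hmem : ∀ M, IsMinimalSemiflowSet Φ M → ∀ p ∈ M, p.2 = η M p.1 := by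
    intro M hM p hp
    rw [hgraph M hM] at hp
    obtain ⟨ω', rfl⟩ := hp
    rfl
  have hmem' : ∀ M, IsMinimalSemiflowSet Φ M → ∀ ω', (ω', η M ω') ∈ M := by
    intro M hM ω'
    have h : (ω', η M ω') ∈ Set.range (fun ω : Ω => (ω, η M ω)) := ⟨ω', rfl⟩
    rwa [← hgraph M hM] at h
  have hattr : ∀ M, IsMinimalSemiflowSet Φ M → ∀ p, (∃ t ≥ (0:ℝ), near M (Φ t p)) →
      Filter.Tendsto (fun t => (Φ t p).2 - η M (σ t p.1)) Filter.atTop (𝓝 0) := by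
    rintro M hM p ⟨s, hs, hnr⟩
    have hexp : Filter.Tendsto (fun t : ℝ => κ M * Real.exp (-γ M * (t - s)) *
        |(Φ s p).2 - η M (Φ s p).1|) Filter.atTop (𝓝 0) := by
      have h1 : Filter.Tendsto (fun t : ℝ => -γ M * (t - s)) Filter.atTop Filter.atBot :=
        (Filter.tendsto_atTop_add_const_right _ (-s) Filter.tendsto_id).const_mul_atTop_of_neg
          (neg_lt_zero.2 (hγ M hM))
      simpa using ((Real.tendsto_exp_atBot.comp h1).const_mul (κ M)).mul_const _
    refine squeeze_zero_norm' ?_ hexp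
    filter_upwards [Filter.eventually_ge_atTop s] with t hts
    have h := hst M hM (Φ s p).1 (Φ s p).2 hnr.le (t - s) (sub_nonneg.2 hts)
    have h2 : Φ (t - s) (Φ s p) = Φ t p := by
      rw [← hΦadd _ (sub_nonneg.2 hts) _ hs, sub_add_cancel]
    have h3 : σ (t - s) (Φ s p).1 = σ t p.1 := by
      rw [hskew s hs, ← hσadd, sub_add_cancel]
    rwa [Prod.mk.eta, h2, h3] at h
  have huniq : ∀ M, IsMinimalSemiflowSet Φ M → ∀ N, IsMinimalSemiflowSet Φ N → ∀ p,
      (∃ t ≥ (0:ℝ), near M (Φ t p)) → (∃ t ≥ (0:ℝ), near N (Φ t p)) → M = N := by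
    intro M hM N hN p hpM hpN
    have hlim := (hattr N hN p hpN).sub (hattr M hM p hpM)
    simp only [sub_sub_sub_cancel_left, sub_zero] at hlim
    have hdiff : Continuous fun ω' => η M ω' - η N ω' := (hη M hM).sub (hη N hN)
    have hclosed : IsClosed (Set.range fun ω' => η M ω' - η N ω') :=
      (isCompact_range hdiff).isClosed
    obtain ⟨ω', h0⟩ := hclosed.mem_of_tendsto hlim
      (Filter.Eventually.of_forall fun t => ⟨σ t p.1, rfl⟩)
    exact hM.eq_of_mem hcont hΦadd hN (hmem' M hM ω') (sub_eq_zero.1 h0 ▸ hmem' N hN ω')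
  have hex : ∀ x : ℝ, ∃ M, IsMinimalSemiflowSet Φ M ∧ ∃ t ≥ (0:ℝ), near M (Φ t (ω, x)) := by
    intro x
    obtain ⟨M, hMsub, hM⟩ :=
      exists_isMinimalSemiflowSet_subset_closure_orbit hcont hΦadd (hbddorb (ω, x))
    obtain ⟨q, hq⟩ := hM.1
    have hqn : near M q := by simpa [near, hmem M hM q hq] using hδ M hM
    obtain ⟨_, hn, t, ht, rfl⟩ := mem_closure_iff.1 (hMsub hq) _ (hnear M hM) hqn
    exact ⟨M, hM, t, ht, hn⟩
  choose f hf hfn using hex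
  have hloc : IsLocallyConstant f := by
    refine (IsLocallyConstant.iff_eventually_eq f).2 fun x => ?_
    obtain ⟨t, ht, hn⟩ := hfn x
    have hc : Continuous fun y : ℝ => Φ t (ω, y) := (hcont t ht).comp (by fun_prop)
    filter_upwards [((hnear _ (hf x)).preimage hc).mem_nhds hn] with y hy
    exact huniq _ (hf y) _ (hf x) (ω, y) (hfn y) ⟨t, ht, hy⟩
  refine ⟨f 0, hf 0, fun M hM => ?_⟩
  rw [hloc.apply_eq_of_isPreconnected isPreconnected_univ (Set.mem_univ 0)
    (Set.mem_univ (η M ω))]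
  refine huniq _ hM _ (hf _) (ω, η M ω) ⟨0, le_rfl, ?_⟩ (hfn _)
  simpa [near, hΦ0] using hδ M hM
end

section
/- Let σ be a minimal continuous flow on a nonempty compact metric space Ω, let a, b : Ω → ℝ be continuous, let r₁ ≤ r₂ be real numbers, and let g : Ω × ℝ → ℝ satisfy: (g1) g and its partial derivative g_x with respect to the second variable exist and are continuous on Ω × ℝ; (g2) g(ω,x) = 0 for r₁ ≤ x ≤ r₂, g(ω,x) > 0 for x < r₁, g(ω,x) < 0 for x > r₂, and g_x(ω,r₁) = 0 for all ω if r₁ = r₂. Assume a admits a continuous primitive. Let M ⊆ Ω × [r₁,r₂] be a nonempty compact set carrying a continuous flow τ of skewproduct form τ(t,(ω,x)) = (ω·t, X(t,ω,x)) with strictly increasing fiber maps, such that for every (ω,x₀) ∈ M the map t ↦ X(t,ω,x₀) is differentiable with derivative a(ω·t)·X(t,ω,x₀) + b(ω·t) + g(ω·t, X(t,ω,x₀)), and such that M is τ-minimal. Then: (1) the Sacker–Sell spectrum of a is {0}; (2) M is a copy of the base: for every ω ∈ Ω the fiber {x : (ω,x) ∈ M} is a singleton {η(ω)}, and η : Ω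 → ℝ is continuous. -/
open MeasureTheory Topology

/-- The family `x' = c(ω·t)x` has exponential dichotomy over `Ω`. -/
def ExpDichotomy {Ω : Type*} (σ : ℝ → Ω → Ω) (c : Ω → ℝ) : Prop :=
  ∃ κ ≥ (1:ℝ), ∃ γ > (0:ℝ),
    (∀ ω : Ω, ∀ t ≥ (0:ℝ),
        Real.exp (∫ s in (0:ℝ)..t, c (σ s ω)) ≤ κ * Real.exp (-γ * t)) ∨
    (∀ ω : Ω, ∀ t ≤ (0:ℝ),
        Real.exp (∫ s in (0:ℝ)..t, c (σ s ω)) ≤ κ * Real.exp (γ * t))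

section Primitive

variable {Ω : Type*} [TopologicalSpace Ω] {σ : ℝ → Ω → Ω} {a h : Ω → ℝ}

/-- The integral of a shifted function with a primitive along an orbit. -/
theorem integral_sub_const_of_primitive (hσ : ∀ ω, Continuous fun t => σ t ω) (ha : Continuous a)
    (hh : ∀ ω t, h (σ t ω) - h ω = ∫ s in (0:ℝ)..t, a (σ s ω)) (lam : ℝ) (ω : Ω) (t : ℝ) :
    ∫ s in (0:ℝ)..t, (a (σ s ω) - lam) = h (σ t ω) - h ω - lam * t := by
  rw [intervalIntegral.integral_sub (Continuous.intervalIntegrable (u := fun s => a (σ s ω)) (ha.comp (hσ ω)) _ _)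
    intervalIntegrable_const, hh]
  simp [mul_comm]

/-- A function with a bounded primitive has Sacker–Sell spectrum `{0}`. -/
theorem spectrum_eq_zero_of_primitive [Nonempty Ω] [CompactSpace Ω]
    (hσ : ∀ ω, Continuous fun t => σ t ω) (ha : Continuous a) (hhc : Continuous h)
    (hh : ∀ ω t, h (σ t ω) - h ω = ∫ s in (0:ℝ)..t, a (σ s ω)) :
    {lam : ℝ | ¬ ExpDichotomy σ (fun ω => a ω - lam)} = {0} := by
  obtain ⟨C, hC⟩ := isCompact_univ.exists_bound_of_continuousOn hhc.continuousOn
  have hC' : ∀ ω, -C ≤ h ω ∧ h ω ≤ C := fun ω => abs_le.1 (hC ω trivial)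
  obtain ⟨ω₀⟩ := ‹Nonempty Ω›
  have hC0 : 0 ≤ C := by linarith [(hC' ω₀).1, (hC' ω₀).2]
  ext lam
  simp only [Set.mem_ofPred_eq, Set.mem_singleton_iff]
  constructor
  · intro hn
    by_contra hl
    refine hn ⟨Real.exp (2 * C), Real.one_le_exp (by linarith), |lam|, abs_pos.2 hl, ?_⟩
    simp only [integral_sub_const_of_primitive hσ ha hh, ← Real.exp_add, Real.exp_le_exp]
    rcases lt_or_gt_of_ne hl with hneg | hpos
    · right
      intro ω t _
      rw [abs_of_neg hneg]
      linarith [(hC' (σ t ω)).2, (hC' ω).1]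
    · left
      intro ω t _
      rw [abs_of_pos hpos]
      linarith [(hC' (σ t ω)).2, (hC' ω).1]
  · rintro rfl ⟨κ, hκ, γ, hγ, H⟩
    simp only [integral_sub_const_of_primitive hσ ha hh] at H
    have key : ∀ t : ℝ, 0 ≤ t → Real.exp (-(2 * C)) ≤ κ * Real.exp (-γ * t) := by
      intro t ht
      rcases H with H | H
      · refine le_trans (Real.exp_le_exp.2 ?_) (H ω₀ t ht)
        linarith [(hC' (σ t ω₀)).1, (hC' ω₀).2]
      · refine le_trans (Real.exp_le_exp.2 ?_) ((H ω₀ (-t) (by linarith)).trans_eq (by ring_nf))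
        linarith [(hC' (σ (-t) ω₀)).1, (hC' ω₀).2]
    have hlim : Filter.Tendsto (fun t : ℝ => κ * Real.exp (-γ * t)) Filter.atTop (𝓝 0) := by
      have h1 : Filter.Tendsto (fun t : ℝ => -γ * t) Filter.atTop Filter.atBot :=
        Filter.tendsto_id.const_mul_atTop_of_neg (by linarith)
      simpa using (Real.tendsto_exp_atBot.comp h1).const_mul κ
    have hle := ge_of_tendsto hlim
      ((Filter.eventually_ge_atTop (0:ℝ)).mono fun t ht => key t ht)
    exact absurd hle (not_le.2 (Real.exp_pos _))

/-- A primitive along the flow is differentiable along orbits. -/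
theorem hasDerivAt_of_primitive (hσ : ∀ ω, Continuous fun t => σ t ω) (ha : Continuous a)
    (hh : ∀ ω t, h (σ t ω) - h ω = ∫ s in (0:ℝ)..t, a (σ s ω)) (ω : Ω) (t : ℝ) :
    HasDerivAt (fun s => h (σ s ω)) (a (σ t ω)) t := by
  have hc : Continuous fun s => a (σ s ω) := ha.comp (hσ ω)
  have heq : (fun s => h (σ s ω)) = fun s => (∫ u in (0:ℝ)..s, a (σ u ω)) + h ω := by
    funext s
    rw [← hh]
    ring
  rw [heq]
  exact (hc.integral_hasStrictDerivAt 0 t).hasDerivAt.add_const _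

/-- The difference of two solutions of `x' = a(ω·t)x + f(t)`, rescaled by the exponential of
a primitive of `a`, is constant. -/
theorem sub_mul_exp_neg_primitive_eq (hσ : ∀ ω, Continuous fun t => σ t ω)
    (hσ0 : ∀ ω, σ 0 ω = ω) (ha : Continuous a)
    (hh : ∀ ω t, h (σ t ω) - h ω = ∫ s in (0:ℝ)..t, a (σ s ω)) (ω : Ω) {x y f : ℝ → ℝ}
    (hx : ∀ t, HasDerivAt x (a (σ t ω) * x t + f t) t)
    (hy : ∀ t, HasDerivAt y (a (σ t ω) * y t + f t) t) (t : ℝ) :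
    y t = x t + (y 0 - x 0) * Real.exp (-h ω) * Real.exp (h (σ t ω)) := by
  have hd : ∀ s, HasDerivAt (fun s => (y s - x s) * Real.exp (-h (σ s ω))) 0 s := by
    intro s
    refine (((hy s).sub (hx s)).mul
      (hasDerivAt_of_primitive hσ ha hh ω s).neg.exp).congr_deriv ?_
    simp only [Pi.sub_apply]
    ring
  have hconst := is_const_of_deriv_eq_zero (fun s => (hd s).differentiableAt)
    (fun s => (hd s).deriv) 0 t
  simp only [hσ0] at hconst
  rw [hconst, mul_assoc, ← Real.exp_add]
  simp

end Primitive

/-- If `a` admits a continuous primitive and `M ⊆ Ω × [r₁,r₂]` is a minimal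
set of a fiber-monotone skewproduct flow whose fiber motions solve
`x' = a(ω·t)x + b(ω·t) + g(ω·t,x)` with `g` satisfying (g1)-(g2), then the Sacker–Sell
spectrum of `a` is `{0}` and `M` is a copy of the base. -/
theorem stmt17 {Ω : Type*} [MetricSpace Ω] [CompactSpace Ω] [Nonempty Ω]
    (σ : ℝ → Ω → Ω)
    (hσcont : Continuous fun p : ℝ × Ω => σ p.1 p.2)
    (hσ0 : ∀ ω, σ 0 ω = ω)
    (hσadd : ∀ s t ω, σ (s + t) ω = σ s (σ t ω))
    (hmin : ∀ ω : Ω, Dense (Set.range fun t => σ t ω))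
    (a b : Ω → ℝ) (ha : Continuous a) (hb : Continuous b)
    (r₁ r₂ : ℝ) (hr : r₁ ≤ r₂)
    (g gx : Ω → ℝ → ℝ)
    (hg1 : Continuous fun p : Ω × ℝ => g p.1 p.2)
    (hg1x : Continuous fun p : Ω × ℝ => gx p.1 p.2)
    (hgderiv : ∀ (ω : Ω) (x : ℝ), HasDerivAt (g ω) (gx ω x) x)
    (hg2zero : ∀ (ω : Ω) (x : ℝ), r₁ ≤ x → x ≤ r₂ → g ω x = 0)
    (hg2pos : ∀ (ω : Ω) (x : ℝ), x < r₁ → 0 < g ω x)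
    (hg2neg : ∀ (ω : Ω) (x : ℝ), r₂ < x → g ω x < 0)
    (hg2deg : r₁ = r₂ → ∀ ω : Ω, gx ω r₁ = 0)
    (hprim : ∃ h : Ω → ℝ, Continuous h ∧
      ∀ ω t, h (σ t ω) - h ω = ∫ s in (0:ℝ)..t, a (σ s ω))
    (M : Set (Ω × ℝ)) (hMne : M.Nonempty) (hMcomp : IsCompact M)
    (hMband : ∀ p ∈ M, p.2 ∈ Set.Icc r₁ r₂)
    (τ : ℝ → M → M)
    (hτcont : Continuous fun p : ℝ × M => τ p.1 p.2)
    (hτ0 : ∀ p : M, τ 0 p = p)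
    (hτadd : ∀ s t : ℝ, ∀ p : M, τ (s + t) p = τ s (τ t p))
    (hskew : ∀ t : ℝ, ∀ p : M, (τ t p).1.1 = σ t p.1.1)
    (hmono : ∀ t : ℝ, ∀ p q : M, p.1.1 = q.1.1 → p.1.2 < q.1.2 →
      (τ t p).1.2 < (τ t q).1.2)
    (hODE : ∀ (p : M) (t : ℝ), HasDerivAt (fun s : ℝ => (τ s p).1.2)
      (a (σ t p.1.1) * (τ t p).1.2 + b (σ t p.1.1) + g (σ t p.1.1) ((τ t p).1.2)) t)
    (hminimal : ∀ K : Set M, K.Nonempty → IsCompact K →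
      (∀ t : ℝ, τ t '' K = K) → K = Set.univ) :
    {lam : ℝ | ¬ ExpDichotomy σ (fun ω => a ω - lam)} = {0} ∧
    ∃ η : Ω → ℝ, Continuous η ∧ M = Set.range (fun ω : Ω => (ω, η ω)) := by
  obtain ⟨h, hhc, hh⟩ := hprim
  have hσ : ∀ ω, Continuous fun t => σ t ω := fun ω =>
    hσcont.comp (continuous_id.prodMk continuous_const)
  refine ⟨spectrum_eq_zero_of_primitive hσ ha hhc hh, ?_⟩
  have : CompactSpace M := isCompact_iff_compactSpace.1 hMcomp
  have : Nonempty M := hMne.to_subtype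
  have hlin : ∀ (p : M) (t : ℝ), HasDerivAt (fun s : ℝ => (τ s p).1.2)
      (a (σ t p.1.1) * (τ t p).1.2 + b (σ t p.1.1)) t := by
    intro p t
    have hb := hMband _ (τ t p).2
    refine (hODE p t).congr_deriv ?_
    rw [hg2zero _ _ hb.1 hb.2, add_zero]
  have hdiff : ∀ (p q : M), p.1.1 = q.1.1 → ∀ t, (τ t q).1.2 = (τ t p).1.2 +
      (q.1.2 - p.1.2) * Real.exp (-h p.1.1) * Real.exp (h (σ t p.1.1)) := by
    intro p q hpq t
    have hq := hlin q
    rw [← hpq] at hq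
    simpa [hτ0] using sub_mul_exp_neg_primitive_eq hσ hσ0 ha hh p.1.1 (hlin p) hq t
  have hnlt : ∀ p q : M, p.1.1 = q.1.1 → ¬ p.1.2 < q.1.2 := by
    intro p q hpq hlt
    set c := (q.1.2 - p.1.2) * Real.exp (-h p.1.1) with hc
    have hcpos : 0 < c := mul_pos (sub_pos.2 hlt) (Real.exp_pos _)
    set K : Set M := {m | (m.1.1, m.1.2 + c * Real.exp (h m.1.1)) ∈ M} with hK
    have hKclosed : IsClosed K := hMcomp.isClosed.preimage (by fun_prop)
    have hpK : p ∈ K := by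
      have : p.1.2 + c * Real.exp (h p.1.1) = q.1.2 := by
        rw [hc, mul_assoc, ← Real.exp_add]
        simp
      simp only [hK, Set.mem_ofPred_eq, this]
      rw [hpq]
      exact q.2
    have hinv : ∀ t, ∀ m ∈ K, τ t m ∈ K := by
      intro t m hm
      have hd := hdiff m ⟨_, hm⟩ rfl t
      simp only [add_sub_cancel_left] at hd
      rw [mul_assoc c, ← Real.exp_add, add_neg_cancel, Real.exp_zero, mul_one] at hd
      have h1 := hskew t ⟨_, hm⟩
      simp only [hK, Set.mem_ofPred_eq, hskew]
      rw [← hd]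
      have h2 := (τ t ⟨_, hm⟩).2
      rwa [← Prod.mk.eta (p := (τ t ⟨_, hm⟩).1), h1] at h2
    have hKuniv := hminimal K ⟨p, hpK⟩ hKclosed.isCompact fun t => by
      refine Set.Subset.antisymm (Set.image_subset_iff.2 (hinv t)) fun m hm =>
        ⟨τ (-t) m, hinv _ m hm, ?_⟩
      rw [← hτadd, add_neg_cancel, hτ0]
    obtain ⟨m, -, hm⟩ := isCompact_univ.exists_isMaxOn (Set.univ_nonempty (α := M))
      (f := fun m : M => m.1.2 * Real.exp (-h m.1.1)) (by fun_prop)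
    have hmK : m ∈ K := hKuniv ▸ Set.mem_univ m
    have hle : (m.1.2 + c * Real.exp (h m.1.1)) * Real.exp (-h m.1.1) ≤
        m.1.2 * Real.exp (-h m.1.1) := hm (Set.mem_univ (⟨_, hmK⟩ : M))
    rw [add_mul, mul_assoc c, ← Real.exp_add, add_neg_cancel, Real.exp_zero] at hle
    linarith
  let π : M → Ω := fun m => m.1.1
  have hπ : Continuous π := by fun_prop
  have hinj : Function.Injective π := fun p q hpq =>
    Subtype.ext (Prod.ext hpq (le_antisymm (not_lt.1 (hnlt q p hpq.symm)) (not_lt.1 (hnlt p q hpq))))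
  have hsurj : Function.Surjective π := by
    obtain ⟨p⟩ := ‹Nonempty M›
    have hd : DenseRange π := (hmin p.1.1).mono <| by
      rintro _ ⟨t, rfl⟩
      exact ⟨τ t p, hskew t p⟩
    rw [← Set.range_eq_univ, ← (isCompact_range hπ).isClosed.closure_eq]
    exact hd.closure_range
  let e : M ≃ₜ Ω := Continuous.homeoOfEquivCompactToT2 (f := Equiv.ofBijective π ⟨hinj, hsurj⟩) hπ
  have he : ∀ ω, (e.symm ω).1.1 = ω := e.apply_symm_apply
  refine ⟨fun ω => (e.symm ω).1.2, by fun_prop, Set.Subset.antisymm (fun p hp => ?_) ?_⟩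
  · refine ⟨p.1, ?_⟩
    have : e.symm p.1 = ⟨p, hp⟩ := e.symm_apply_apply ⟨p, hp⟩
    simp [this]
  · rintro _ ⟨ω, rfl⟩
    have h2 := (e.symm ω).2
    rwa [← Prod.mk.eta (p := (e.symm ω).1), he] at h2
end

section
/- Let σ be a minimal continuous flow on a nonempty compact metric space Ω, let a, b : Ω → ℝ be continuous, let r₁ ≤ r₂ be real numbers, and let g : Ω × ℝ → ℝ satisfy: (g1) g and its partial derivative g_x with respect to the second variable exist and are continuous on Ω × ℝ; (g2) g(ω,x) = 0 for r₁ ≤ x ≤ r₂, g(ω,x) > 0 for x < r₁, g(ω,x) < 0 for x > r₂, and g_x(ω,r₁) = 0 for all ω if r₁ = r₂; (g3) g(ω,x)/x → −∞ as |x| → ∞, uniformly in ω ∈ Ω. Let α, β : Ω → ℝ be bounded with α lower semicontinuous, β upper semicontinuous, α ≤ β; set A := ⋃_{ω∈Ω} {ω} × [α(ω), β(ω)], and let τ be a continuous flow on A of skewproduct form τ(t,(ω,x)) = (ω·t, X(t,ω,x)) with strictly increasing fiber maps, whose fiber motions solve the equation: for every (ω,x₀) ∈ A the map t ↦ X(t,ω,x₀)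 is differentiable with derivative a(ω·t)·X(t,ω,x₀) + b(ω·t) + g(ω·t, X(t,ω,x₀)); assume the graphs of α and β are τ-invariant. Assume moreover that 0 belongs to the Sacker–Sell spectrum of a, that m is a σ-ergodic Borel probability measure with ∫_Ω a dm = 0 and a ∈ R_m(Ω), and that there exists a nonempty compact τ-invariant set M ⊆ A ∩ (Ω × [r₁,r₂]). Then the σ-invariant set Ω_l := { ω ∈ Ω : sup_{t ∈ ℝ} ∫_0^t a(ω·s) ds < ∞ and r₁ ≤ α(ω·t) ≤ β(ω·t) ≤ r₂ for all t ∈ ℝ } satisfies m(Ω_l) = 1. -/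
open MeasureTheory Topology

/-- If a nonnegative function `f` satisfies `f ∘ T - f + φ ≥ 0` with `φ` bounded of zero mean and
`T` measure preserving, then `f ∘ T - f + φ` vanishes almost everywhere. -/
lemma MeasureTheory.MeasurePreserving.ae_comp_sub_add_eq_zero {X : Type*} [MeasurableSpace X]
    {μ : Measure X} [IsProbabilityMeasure μ] {T : X → X} (hT : MeasurePreserving T μ μ)
    {f φ : X → ℝ} (hf : Measurable f) (hf0 : ∀ x, 0 ≤ f x) (hφ : Measurable φ)
    {C : ℝ} (hφC : ∀ x, |φ x| ≤ C) (hφ0 : ∫ x, φ x ∂μ = 0)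
    (h : ∀ᵐ x ∂μ, 0 ≤ f (T x) - f x + φ x) :
    ∀ᵐ x ∂μ, f (T x) - f x + φ x = 0 := by
  have hfT : Measurable fun x => f (T x) := hf.comp hT.measurable
  have hφi : Integrable φ μ := Integrable.of_bound hφ.aestronglyMeasurable C
    (Filter.Eventually.of_forall hφC)
  have hnn : ∀ᵐ x ∂μ, 0 ≤ f (T x) - f x + C := by
    filter_upwards [h] with x hx
    have := (abs_le.1 (hφC x)).2
    linarith
  have hC : 0 ≤ C := by
    obtain ⟨x, -⟩ := (MeasureTheory.ae_neBot.2 (IsProbabilityMeasure.ne_zero μ)).nonempty_of_mem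
      (Filter.univ_mem (f := ae μ))
    exact (abs_nonneg _).trans (hφC x)
  have htrunc : ∀ n : ℕ,
      ∫⁻ x, ENNReal.ofReal (min (f (T x)) n - min (f x) n + C) ∂μ = ENNReal.ofReal C := by
    intro n
    have hi : Integrable (fun x => min (f x) (n : ℝ)) μ := by
      refine Integrable.of_bound (hf.min measurable_const).aestronglyMeasurable n
        (Filter.Eventually.of_forall fun x => ?_)
      rw [Real.norm_of_nonneg (le_min (hf0 x) n.cast_nonneg)]
      exact min_le_right _ _
    have hiT : Integrable (fun x => min (f (T x)) (n : ℝ)) μ := hT.integrable_comp_of_integrable hi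
    have heq : ∫ x, min (f (T x)) (n : ℝ) ∂μ = ∫ x, min (f x) (n : ℝ) ∂μ := by
      conv_rhs => rw [← hT.map_eq]
      rw [integral_map hT.measurable.aemeasurable (hf.min measurable_const).aestronglyMeasurable]
    have hid : Integrable (fun x => min (f (T x)) (n : ℝ) - min (f x) n) μ := hiT.sub hi
    have hidC : Integrable (fun x => min (f (T x)) (n : ℝ) - min (f x) n + C) μ :=
      hid.add (integrable_const C)
    rw [← ofReal_integral_eq_lintegral_ofReal hidC]
    · rw [integral_add hid (integrable_const C), integral_sub hiT hi, heq]
      simp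
    · filter_upwards [hnn] with x hx
      rw [Pi.zero_apply]
      rcases le_total (f (T x)) n with h1 | h1 <;> rcases le_total (f x) n with h2 | h2 <;>
        simp only [h1, h2, min_eq_left, min_eq_right] <;> linarith
  have hfin : ∫⁻ x, ENNReal.ofReal (f (T x) - f x + C) ∂μ ≤ ENNReal.ofReal C := by
    calc ∫⁻ x, ENNReal.ofReal (f (T x) - f x + C) ∂μ
        = ∫⁻ x, Filter.liminf (fun n : ℕ =>
            ENNReal.ofReal (min (f (T x)) n - min (f x) n + C)) Filter.atTop ∂μ := by
          refine lintegral_congr fun x => (Filter.Tendsto.liminf_eq ?_).symm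
          refine tendsto_const_nhds.congr' ?_
          obtain ⟨N, hN⟩ := exists_nat_ge (max (f (T x)) (f x))
          filter_upwards [Filter.eventually_ge_atTop N] with n hn
          have hn' : max (f (T x)) (f x) ≤ n := hN.trans (by exact_mod_cast hn)
          rw [min_eq_left ((le_max_left _ _).trans hn'), min_eq_left ((le_max_right _ _).trans hn')]
      _ ≤ Filter.liminf (fun n : ℕ =>
            ∫⁻ x, ENNReal.ofReal (min (f (T x)) n - min (f x) n + C) ∂μ) Filter.atTop :=
          lintegral_liminf_le fun n => (((hfT.min measurable_const).sub
            (hf.min measurable_const)).add_const C).ennreal_ofReal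
      _ = ENNReal.ofReal C := by simp only [htrunc, Filter.liminf_const]
  have hm : Measurable fun x => f (T x) - f x + C := (hfT.sub hf).add_const C
  have hi : Integrable (fun x => f (T x) - f x + C) μ :=
    ⟨hm.aestronglyMeasurable,
      (hasFiniteIntegral_iff_ofReal hnn).2 (hfin.trans_lt ENNReal.ofReal_lt_top)⟩
  have hle : ∫ x, (f (T x) - f x + C) ∂μ ≤ C := by
    rw [integral_eq_lintegral_of_nonneg_ae hnn hm.aestronglyMeasurable]
    exact ENNReal.toReal_le_of_le_ofReal hC hfin
  have hsplit : (fun x => f (T x) - f x + φ x)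
      = fun x => (f (T x) - f x + C) + (φ x - C) := by
    funext x; ring
  have hφCi : Integrable (fun x => φ x - C) μ := hφi.sub (integrable_const C)
  have hi' : Integrable (fun x => f (T x) - f x + φ x) μ := by
    rw [hsplit]; exact hi.add hφCi
  have hval : ∫ x, (f (T x) - f x + φ x) ∂μ ≤ 0 := by
    rw [hsplit, integral_add hi hφCi,
      integral_sub hφi (integrable_const C), hφ0]
    simpa using hle
  exact (integral_eq_zero_iff_of_nonneg_ae h hi').1
    (le_antisymm hval (integral_nonneg_of_ae h))

/-- A real function which does not increase along a measure preserving map is almost everywhere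
invariant. -/
lemma MeasureTheory.MeasurePreserving.ae_comp_eq_of_ae_comp_le {X : Type*} [MeasurableSpace X]
    {μ : Measure X} [IsProbabilityMeasure μ] {T : X → X} (hT : MeasurePreserving T μ μ)
    {W : X → ℝ} (hW : Measurable W) (h : ∀ᵐ x ∂μ, W (T x) ≤ W x) :
    ∀ᵐ x ∂μ, W (T x) = W x := by
  have hm : Measurable fun x => Real.arctan (W x) := Real.measurable_arctan.comp hW
  have hi : Integrable (fun x => Real.arctan (W x)) μ := by
    refine Integrable.of_bound hm.aestronglyMeasurable (Real.pi / 2)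
      (Filter.Eventually.of_forall fun x => ?_)
    exact abs_le.2 ⟨(Real.neg_pi_div_two_lt_arctan _).le, (Real.arctan_lt_pi_div_two _).le⟩
  have hiT : Integrable (fun x => Real.arctan (W (T x))) μ := hT.integrable_comp_of_integrable hi
  have heq : ∫ x, Real.arctan (W (T x)) ∂μ = ∫ x, Real.arctan (W x) ∂μ := by
    conv_rhs => rw [← hT.map_eq]
    rw [integral_map hT.measurable.aemeasurable hm.aestronglyMeasurable]
  have hnn : 0 ≤ᵐ[μ] fun x => Real.arctan (W x) - Real.arctan (W (T x)) := by
    filter_upwards [h] with x hx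
    exact sub_nonneg.2 (Real.arctan_strictMono.monotone hx)
  have h0 := (integral_eq_zero_iff_of_nonneg_ae hnn (hi.sub hiT)).1
    (by rw [integral_sub hi hiT, heq, sub_self])
  filter_upwards [h0] with x hx
  exact (Real.arctan_injective (sub_eq_zero.1 hx)).symm

section Cocycle

variable {Ω : Type*} {σ : ℝ → Ω → Ω} {a : Ω → ℝ}

lemma continuous_along_orbit [TopologicalSpace Ω] (hσ : Continuous fun p : ℝ × Ω => σ p.1 p.2)
    (ha : Continuous a) (ω : Ω) : Continuous fun s => a (σ s ω) :=
  ha.comp (hσ.comp (Continuous.prodMk continuous_id continuous_const))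

/-- The cocycle identity for `∫₀ᵗ a(ω·s) ds`. -/
lemma integral_along_orbit_shift [TopologicalSpace Ω]
    (hσ : Continuous fun p : ℝ × Ω => σ p.1 p.2)
    (hσadd : ∀ s t ω, σ (s + t) ω = σ s (σ t ω)) (ha : Continuous a) (s t : ℝ) (ω : Ω) :
    ∫ u in (0:ℝ)..s, a (σ u (σ t ω))
      = (∫ u in (0:ℝ)..(s + t), a (σ u ω)) - ∫ u in (0:ℝ)..t, a (σ u ω) := by
  have hc := continuous_along_orbit hσ ha ω
  simp only [← hσadd]
  rw [intervalIntegral.integral_comp_add_right (fun u => a (σ u ω)) t, zero_add,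
    eq_sub_iff_add_eq', intervalIntegral.integral_add_adjacent_intervals
      (hc.intervalIntegrable _ _) (hc.intervalIntegrable _ _)]

lemma abs_integral_along_orbit_le {K : ℝ} (hK : ∀ ω, |a ω| ≤ K) (t : ℝ) (ω : Ω) :
    |∫ s in (0:ℝ)..t, a (σ s ω)| ≤ K * |t| := by
  simpa using intervalIntegral.norm_integral_le_of_norm_le_const
    (a := 0) (b := t) (f := fun s => a (σ s ω)) (C := K) (fun s _ => hK _)

lemma continuous_integral_along_orbit [TopologicalSpace Ω]
    (hσ : Continuous fun p : ℝ × Ω => σ p.1 p.2) (ha : Continuous a) (t : ℝ) :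
    Continuous fun ω => ∫ s in (0:ℝ)..t, a (σ s ω) :=
  intervalIntegral.continuous_parametric_intervalIntegral_of_continuous'
    (f := fun ω s => a (σ s ω)) (ha.comp (hσ.comp continuous_swap)) 0 t

variable [MetricSpace Ω] [CompactSpace Ω] [MeasurableSpace Ω] [BorelSpace Ω]
  {m : Measure Ω} [IsProbabilityMeasure m]

/-- Time averages of a zero mean function along the flow have zero mean. -/
lemma integral_integral_along_orbit_eq_zero (hσ : Continuous fun p : ℝ × Ω => σ p.1 p.2)
    (hm : ∀ t, MeasurePreserving (σ t) m m) (ha : Continuous a) (hint : ∫ ω, a ω ∂m = 0) :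
    ∫ ω, (∫ s in (0:ℝ)..1, a (σ s ω)) ∂m = 0 := by
  obtain ⟨K, hK⟩ := isCompact_univ.exists_bound_of_continuousOn ha.continuousOn
  have hc : Continuous fun p : Ω × ℝ => a (σ p.2 p.1) := ha.comp (hσ.comp continuous_swap)
  have hi : Integrable (Function.uncurry fun (ω : Ω) (s : ℝ) => a (σ s ω))
      (m.prod (volume.restrict (Set.Ioc (0:ℝ) 1))) :=
    Integrable.of_bound hc.aestronglyMeasurable K
      (Filter.Eventually.of_forall fun p => hK _ (Set.mem_univ _))
  simp only [intervalIntegral.integral_of_le zero_le_one]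
  rw [integral_integral_swap hi]
  have : ∀ s, ∫ ω, a (σ s ω) ∂m = 0 := fun s => by
    rw [← hint]
    conv_rhs => rw [← (hm s).map_eq]
    rw [integral_map (hm s).measurable.aemeasurable ha.aestronglyMeasurable]
  simp [this]

/-- If the cocycle of a zero mean function is almost everywhere bounded above on the negative
half-line, then some nonnegative measurable `H` satisfies `H(ω·1) = H(ω) - ∫₀¹ a(ω·s) ds` almost
everywhere. -/
lemma exists_measurable_transfer (hσ : Continuous fun p : ℝ × Ω => σ p.1 p.2)
    (hσadd : ∀ s t ω, σ (s + t) ω = σ s (σ t ω))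
    (hm : ∀ t, MeasurePreserving (σ t) m m) (ha : Continuous a) (hint : ∫ ω, a ω ∂m = 0)
    (hbdd : ∀ᵐ ω ∂m, ∃ C : ℝ, ∀ t ≤ (0:ℝ), (∫ s in (0:ℝ)..t, a (σ s ω)) ≤ C) :
    ∃ H : Ω → ℝ, Measurable H ∧ (∀ ω, 0 ≤ H ω) ∧
      ∀ᵐ ω ∂m, H (σ 1 ω) = H ω - ∫ s in (0:ℝ)..1, a (σ s ω) := by
  obtain ⟨K, hK⟩ := isCompact_univ.exists_bound_of_continuousOn ha.continuousOn
  have hcI := continuous_integral_along_orbit hσ ha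
  set H : Ω → ℝ := fun ω => ⨆ n : ℕ, ∫ s in (0:ℝ)..(-n), a (σ s ω) with hH
  have hHm : Measurable H := Measurable.iSup fun n => (hcI _).measurable
  have hH0 : ∀ ω, 0 ≤ H ω := fun ω => by
    by_cases hB : BddAbove (Set.range fun n : ℕ => ∫ s in (0:ℝ)..(-n), a (σ s ω))
    · have := le_ciSup hB 0
      simpa using this
    · exact (Real.iSup_of_not_bddAbove hB).ge
  have hB : ∀ᵐ ω ∂m, BddAbove (Set.range fun n : ℕ => ∫ s in (0:ℝ)..(-n), a (σ s ω)) := by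
    filter_upwards [hbdd] with ω ⟨C, hC⟩
    refine ⟨C, ?_⟩
    rintro _ ⟨n, rfl⟩
    exact hC _ (by simp)
  have hle : ∀ᵐ ω ∂m, ∀ n : ℕ, (∫ s in (0:ℝ)..(-n), a (σ s ω)) ≤ H ω := by
    filter_upwards [hB] with ω hω n
    exact le_ciSup hω n
  refine ⟨H, hHm, hH0, ?_⟩
  have hnn : ∀ᵐ ω ∂m, 0 ≤ H (σ 1 ω) - H ω + ∫ s in (0:ℝ)..1, a (σ s ω) := by
    filter_upwards [(hm 1).quasiMeasurePreserving.ae hle] with ω hω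
    have : H ω ≤ H (σ 1 ω) + ∫ s in (0:ℝ)..1, a (σ s ω) := by
      refine ciSup_le fun n => ?_
      have h1 := hω (n + 1)
      rw [integral_along_orbit_shift hσ hσadd ha] at h1
      have h2 : -((n + 1 : ℕ) : ℝ) + 1 = -n := by push_cast; ring
      rw [h2] at h1
      linarith
    linarith
  filter_upwards [(hm 1).ae_comp_sub_add_eq_zero hHm hH0 (hcI 1).measurable
    (C := K) (fun ω => by
      simpa using abs_integral_along_orbit_le (σ := σ) (fun ω => hK ω (Set.mem_univ _)) 1 ω)
    (integral_integral_along_orbit_eq_zero hσ hm ha hint) hnn] with ω hω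
  linarith

/-- If the cocycle of a zero mean function is almost everywhere bounded above on the negative
half-line, then it is almost everywhere bounded above. -/
lemma ae_bddAbove_integral_along_orbit (hσ : Continuous fun p : ℝ × Ω => σ p.1 p.2)
    (hσ0 : ∀ ω, σ 0 ω = ω) (hσadd : ∀ s t ω, σ (s + t) ω = σ s (σ t ω))
    (hm : ∀ t, MeasurePreserving (σ t) m m) (ha : Continuous a) (hint : ∫ ω, a ω ∂m = 0)
    (hbdd : ∀ᵐ ω ∂m, ∃ C : ℝ, ∀ t ≤ (0:ℝ), (∫ s in (0:ℝ)..t, a (σ s ω)) ≤ C) :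
    ∀ᵐ ω ∂m, ∃ C : ℝ, ∀ t : ℝ, (∫ s in (0:ℝ)..t, a (σ s ω)) ≤ C := by
  obtain ⟨K, hK⟩ := isCompact_univ.exists_bound_of_continuousOn ha.continuousOn
  obtain ⟨H, -, hH0, hH1⟩ := exists_measurable_transfer hσ hσadd hm ha hint hbdd
  have hH1' : ∀ᵐ ω ∂m, ∀ n : ℕ,
      H (σ 1 (σ n ω)) = H (σ n ω) - ∫ s in (0:ℝ)..1, a (σ s (σ n ω)) :=
    ae_all_iff.2 fun n => (hm n).quasiMeasurePreserving.ae hH1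
  filter_upwards [hbdd, hH1'] with ω ⟨C, hC⟩ hω
  have hHn : ∀ n : ℕ, H (σ n ω) = H ω - ∫ s in (0:ℝ)..n, a (σ s ω) := by
    intro n
    induction n with
    | zero => simp [hσ0]
    | succ n ih =>
      have h1 := hω n
      rw [integral_along_orbit_shift hσ hσadd ha, ← hσadd, add_comm (1:ℝ), ih] at h1
      push_cast
      linarith
  refine ⟨max C (H ω + K), fun t => ?_⟩
  rcases le_total t 0 with ht | ht
  · exact (hC t ht).trans (le_max_left _ _)
  refine le_trans ?_ (le_max_right _ _)
  have h1 := integral_along_orbit_shift hσ hσadd ha (t - ⌊t⌋₊) ⌊t⌋₊ ω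
  rw [sub_add_cancel] at h1
  have h2 := (le_abs_self _).trans
    (abs_integral_along_orbit_le (σ := σ) (fun ω => hK ω (Set.mem_univ _)) (t - ⌊t⌋₊)
      (σ ⌊t⌋₊ ω))
  have h3 : |t - ⌊t⌋₊| ≤ 1 := by
    rw [abs_of_nonneg (sub_nonneg.2 (Nat.floor_le ht))]
    linarith [Nat.lt_floor_add_one t]
  have hK0 : 0 ≤ K := (norm_nonneg _).trans (hK ω (Set.mem_univ _))
  have h4 : K * |t - ⌊t⌋₊| ≤ K := mul_le_of_le_one_right hK0 h3
  have h5 := hHn ⌊t⌋₊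
  have h6 := hH0 (σ ⌊t⌋₊ ω)
  linarith

/-- Along almost every orbit, a measurable `w` with `w' = a w + G`, `G ≤ 0`, in fact
satisfies `G = 0`. -/
lemma ae_forall_forcing_eq_zero (hσ : Continuous fun p : ℝ × Ω => σ p.1 p.2)
    (hσ0 : ∀ ω, σ 0 ω = ω) (hσadd : ∀ s t ω, σ (s + t) ω = σ s (σ t ω))
    (hm : ∀ t, MeasurePreserving (σ t) m m) (ha : Continuous a) (hint : ∫ ω, a ω ∂m = 0)
    (hbdd : ∀ᵐ ω ∂m, ∃ C : ℝ, ∀ t ≤ (0:ℝ), (∫ s in (0:ℝ)..t, a (σ s ω)) ≤ C)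
    {w G : Ω → ℝ} (hw : Measurable w) (hG : ∀ ω, G ω ≤ 0)
    (hGc : ∀ ω, Continuous fun t => G (σ t ω))
    (hderiv : ∀ ω t, HasDerivAt (fun s => w (σ s ω)) (a (σ t ω) * w (σ t ω) + G (σ t ω)) t) :
    ∀ᵐ ω ∂m, ∀ t, G (σ t ω) = 0 := by
  obtain ⟨H, hHm, -, hH1⟩ := exists_measurable_transfer hσ hσadd hm ha hint hbdd
  set φ : Ω → ℝ → ℝ := fun ω t => w (σ t ω) * Real.exp (-∫ s in (0:ℝ)..t, a (σ s ω)) with hφ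
  have hφd : ∀ ω t, HasDerivAt (φ ω)
      (G (σ t ω) * Real.exp (-∫ s in (0:ℝ)..t, a (σ s ω))) t := by
    intro ω t
    have hc := continuous_along_orbit hσ ha ω
    have hI : HasDerivAt (fun t => ∫ s in (0:ℝ)..t, a (σ s ω)) (a (σ t ω)) t :=
      hc.integral_hasStrictDerivAt 0 t |>.hasDerivAt
    refine ((hderiv ω t).mul hI.neg.exp).congr_deriv ?_
    simp only [Pi.neg_apply]
    ring
  have hφanti : ∀ ω, Antitone (φ ω) := fun ω =>
    antitone_of_hasDerivAt_nonpos (hφd ω) fun t =>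
      mul_nonpos_of_nonpos_of_nonneg (hG _) (Real.exp_pos _).le
  have hφ0 : ∀ ω, φ ω 0 = w ω := fun ω => by simp [hφ, hσ0]
  have hW : Measurable fun ω => w ω * Real.exp (H ω) := hw.mul hHm.exp
  have hstep : ∀ᵐ ω ∂m, w (σ 1 ω) * Real.exp (H (σ 1 ω)) = φ ω 1 * Real.exp (H ω) := by
    filter_upwards [hH1] with ω hω
    rw [hω, sub_eq_neg_add, Real.exp_add, ← mul_assoc]
  have hconst : ∀ᵐ ω ∂m, φ ω 1 = φ ω 0 := by
    have hle : ∀ᵐ ω ∂m, w (σ 1 ω) * Real.exp (H (σ 1 ω)) ≤ w ω * Real.exp (H ω) := by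
      filter_upwards [hstep] with ω hω
      rw [hω, ← hφ0]
      exact mul_le_mul_of_nonneg_right (hφanti ω zero_le_one) (Real.exp_pos _).le
    filter_upwards [hstep, (hm 1).ae_comp_eq_of_ae_comp_le hW hle] with ω h1 h2
    rw [h1, ← hφ0] at h2
    exact mul_right_cancel₀ (Real.exp_pos _).ne' h2
  have hunit : ∀ᵐ ω ∂m, ∀ t ∈ Set.Icc (0:ℝ) 1, G (σ t ω) = 0 := by
    filter_upwards [hconst] with ω hω
    have hopen : Set.Ioo (0:ℝ) 1 ⊆ {t | G (σ t ω) = 0} := by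
      intro t ht
      have hev : φ ω =ᶠ[𝓝 t] fun _ => φ ω 0 := by
        filter_upwards [Ioo_mem_nhds ht.1 ht.2] with s hs
        exact le_antisymm (hφanti ω hs.1.le) (hω ▸ hφanti ω hs.2.le)
      have h0 := (hφd ω t).unique ((hasDerivAt_const t (φ ω 0)).congr_of_eventuallyEq hev)
      exact (mul_eq_zero.1 h0).resolve_right (Real.exp_pos _).ne'
    have hcl := closure_minimal hopen (isClosed_eq (hGc ω) continuous_const)
    rwa [closure_Ioo zero_ne_one] at hcl
  have hall : ∀ᵐ ω ∂m, ∀ n : ℤ, ∀ t ∈ Set.Icc (0:ℝ) 1, G (σ t (σ n ω)) = 0 :=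
    ae_all_iff.2 fun n => (hm n).quasiMeasurePreserving.ae hunit
  filter_upwards [hall] with ω hω t
  have := hω ⌊t⌋ (Int.fract t) ⟨Int.fract_nonneg t, (Int.fract_lt_one t).le⟩
  rwa [← hσadd, Int.fract_add_floor] at this

end Cocycle

/-- In the dissipative setting with `0` in the Sacker–Sell spectrum of `a`,
`a ∈ R_m(Ω)` for a `σ`-ergodic measure `m` with `∫ a dm = 0`, and a nonempty compact
`τ`-invariant set inside `Ω × [r₁,r₂]`, the `σ`-invariant set `Ω_l` of points whose
cocycle is bounded above and whose whole `α`/`β`-orbit stays in `[r₁,r₂]` has full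
`m`-measure. -/
theorem stmt18 {Ω : Type*} [MetricSpace Ω] [CompactSpace Ω] [Nonempty Ω]
    [MeasurableSpace Ω] [BorelSpace Ω]
    (σ : ℝ → Ω → Ω)
    (hσcont : Continuous fun p : ℝ × Ω => σ p.1 p.2)
    (hσ0 : ∀ ω, σ 0 ω = ω)
    (hσadd : ∀ s t ω, σ (s + t) ω = σ s (σ t ω))
    (hmin : ∀ ω : Ω, Dense (Set.range fun t => σ t ω))
    (a b : Ω → ℝ) (ha : Continuous a) (hb : Continuous b)
    (r₁ r₂ : ℝ) (hr : r₁ ≤ r₂)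
    (g gx : Ω → ℝ → ℝ)
    (hg1 : Continuous fun p : Ω × ℝ => g p.1 p.2)
    (hg1x : Continuous fun p : Ω × ℝ => gx p.1 p.2)
    (hgderiv : ∀ (ω : Ω) (x : ℝ), HasDerivAt (g ω) (gx ω x) x)
    (hg2zero : ∀ (ω : Ω) (x : ℝ), r₁ ≤ x → x ≤ r₂ → g ω x = 0)
    (hg2pos : ∀ (ω : Ω) (x : ℝ), x < r₁ → 0 < g ω x)
    (hg2neg : ∀ (ω : Ω) (x : ℝ), r₂ < x → g ω x < 0)
    (hg2deg : r₁ = r₂ → ∀ ω : Ω, gx ω r₁ = 0)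
    (hg3 : ∀ C : ℝ, ∃ R > (0:ℝ), ∀ (ω : Ω) (x : ℝ), R ≤ |x| → g ω x / x ≤ -C)
    (α β : Ω → ℝ)
    (hbdd : ∃ C : ℝ, ∀ ω, |α ω| ≤ C ∧ |β ω| ≤ C)
    (hα : LowerSemicontinuous α) (hβ : UpperSemicontinuous β)
    (hαβ : ∀ ω, α ω ≤ β ω)
    (τ : ℝ → Band α β → Band α β)
    (hτcont : Continuous fun p : ℝ × Band α β => τ p.1 p.2)
    (hτ0 : ∀ p, τ 0 p = p)
    (hτadd : ∀ s t : ℝ, ∀ p, τ (s + t) p = τ s (τ t p))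
    (hskew : ∀ t : ℝ, ∀ p : Band α β, (τ t p).1.1 = σ t p.1.1)
    (hmono : ∀ t : ℝ, ∀ p q : Band α β, p.1.1 = q.1.1 → p.1.2 < q.1.2 →
      (τ t p).1.2 < (τ t q).1.2)
    (hODE : ∀ (p : Band α β) (t : ℝ), HasDerivAt (fun s : ℝ => (τ s p).1.2)
      (a (σ t p.1.1) * (τ t p).1.2 + b (σ t p.1.1) + g (σ t p.1.1) ((τ t p).1.2)) t)
    (hinvα : ∀ (ω : Ω) (t : ℝ),
      (τ t ⟨(ω, α ω), ⟨le_rfl, hαβ ω⟩⟩).1 = (σ t ω, α (σ t ω)))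
    (hinvβ : ∀ (ω : Ω) (t : ℝ),
      (τ t ⟨(ω, β ω), ⟨hαβ ω, le_rfl⟩⟩).1 = (σ t ω, β (σ t ω)))
    (hspec : ¬ ExpDichotomy σ a)
    (m : Measure Ω) [IsProbabilityMeasure m]
    (hminv : ∀ t, Measure.map (σ t) m = m)
    (herg : ∀ B : Set Ω, MeasurableSet B → (∀ t, σ t ⁻¹' B = B) → m B = 0 ∨ m B = 1)
    (hint : ∫ ω, a ω ∂m = 0)
    (hnoprim : ¬ ∃ h : Ω → ℝ, Continuous h ∧
      ∀ ω t, h (σ t ω) - h ω = ∫ s in (0:ℝ)..t, a (σ s ω))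
    (hRm : ∀ᵐ ω ∂m, ∃ C : ℝ, ∀ t ≤ (0:ℝ), (∫ s in (0:ℝ)..t, a (σ s ω)) ≤ C)
    (M : Set (Band α β)) (hMne : M.Nonempty) (hMcomp : IsCompact M)
    (hMband : ∀ p ∈ M, p.1.2 ∈ Set.Icc r₁ r₂)
    (hMinv : ∀ t : ℝ, τ t '' M = M) :
    (∀ ω ∈ {ω : Ω | (∃ C : ℝ, ∀ t : ℝ, (∫ s in (0:ℝ)..t, a (σ s ω)) ≤ C) ∧
        ∀ t : ℝ, r₁ ≤ α (σ t ω) ∧ β (σ t ω) ≤ r₂},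
      ∀ t : ℝ, σ t ω ∈ {ω : Ω | (∃ C : ℝ, ∀ t : ℝ, (∫ s in (0:ℝ)..t, a (σ s ω)) ≤ C) ∧
        ∀ t : ℝ, r₁ ≤ α (σ t ω) ∧ β (σ t ω) ≤ r₂}) ∧
    m {ω : Ω | (∃ C : ℝ, ∀ t : ℝ, (∫ s in (0:ℝ)..t, a (σ s ω)) ≤ C) ∧
        ∀ t : ℝ, r₁ ≤ α (σ t ω) ∧ β (σ t ω) ≤ r₂} = 1 := by
  have hm : ∀ t, MeasurePreserving (σ t) m m := fun t =>
    ⟨(hσcont.comp (Continuous.prodMk continuous_const continuous_id)).measurable, hminv t⟩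
  have hMsurj : ∀ ω, ∃ x ∈ Set.Icc r₁ r₂, α ω ≤ x ∧ x ≤ β ω := by
    have hclosed : IsClosed ((fun p : Band α β => p.1.1) '' M) :=
      (hMcomp.image (continuous_fst.comp continuous_subtype_val)).isClosed
    obtain ⟨p, hp⟩ := hMne
    have hsub : Set.range (fun t => σ t p.1.1) ⊆ (fun p : Band α β => p.1.1) '' M := by
      rintro _ ⟨t, rfl⟩
      exact ⟨τ t p, hMinv t ▸ Set.mem_image_of_mem _ hp, hskew t p⟩
    intro ω
    obtain ⟨q, hq, rfl⟩ := closure_minimal hsub hclosed (hmin p.1.1 ω)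
    exact ⟨q.1.2, hMband q hq, q.2⟩
  have hgβ : ∀ ω, g ω (β ω) ≤ 0 := fun ω => by
    obtain ⟨x, hx, -, hxβ⟩ := hMsurj ω
    rcases le_or_gt (β ω) r₂ with h | h
    · exact (hg2zero ω _ (hx.1.trans hxβ) h).le
    · exact (hg2neg ω _ h).le
  have hgα : ∀ ω, 0 ≤ g ω (α ω) := fun ω => by
    obtain ⟨x, hx, hαx, -⟩ := hMsurj ω
    rcases le_or_gt r₁ (α ω) with h | h
    · exact (hg2zero ω _ h (hαx.trans hx.2)).ge
    · exact (hg2pos ω _ h).le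
  have hα' : ∀ ω t, HasDerivAt (fun s => α (σ s ω))
      (a (σ t ω) * α (σ t ω) + b (σ t ω) + g (σ t ω) (α (σ t ω))) t := fun ω t => by
    simpa only [hinvα] using hODE ⟨(ω, α ω), ⟨le_rfl, hαβ ω⟩⟩ t
  have hβ' : ∀ ω t, HasDerivAt (fun s => β (σ s ω))
      (a (σ t ω) * β (σ t ω) + b (σ t ω) + g (σ t ω) (β (σ t ω))) t := fun ω t => by
    simpa only [hinvβ] using hODE ⟨(ω, β ω), ⟨hαβ ω, le_rfl⟩⟩ t
  have hgc : ∀ (f : Ω → ℝ) ω, Continuous (fun t => f (σ t ω)) →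
      Continuous fun t => g (σ t ω) (f (σ t ω)) := fun f ω hf =>
    hg1.comp ((hσcont.comp (Continuous.prodMk continuous_id continuous_const)).prodMk hf)
  have hzero : ∀ᵐ ω ∂m, ∀ t, g (σ t ω) (β (σ t ω)) - g (σ t ω) (α (σ t ω)) = 0 := by
    refine ae_forall_forcing_eq_zero (a := a) (w := fun ω => β ω - α ω)
      (G := fun ω => g ω (β ω) - g ω (α ω)) hσcont hσ0 hσadd hm ha hint hRm
      (hβ.measurable.sub hα.measurable) (fun ω => by linarith [hgβ ω, hgα ω]) (fun ω => ?_)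
      (fun ω t => ?_)
    · exact (hgc β ω (continuous_iff_continuousAt.2 fun t => (hβ' ω t).continuousAt)).sub
        (hgc α ω (continuous_iff_continuousAt.2 fun t => (hα' ω t).continuousAt))
    · exact ((hβ' ω t).sub (hα' ω t)).congr_deriv (by ring)
  refine ⟨?_, ?_⟩
  · rintro ω ⟨⟨C, hC⟩, hω⟩ t
    refine ⟨⟨C - ∫ u in (0:ℝ)..t, a (σ u ω), fun s => ?_⟩, fun s => ?_⟩
    · rw [integral_along_orbit_shift hσcont hσadd ha]
      exact sub_le_sub_right (hC _) _
    · rw [← hσadd]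
      exact hω _
  · rw [← measure_univ (μ := m)]
    refine measure_congr (Filter.eventuallyEq_univ.2 ?_)
    filter_upwards [hzero,
      ae_bddAbove_integral_along_orbit hσcont hσ0 hσadd hm ha hint hRm] with ω h0 hC
    refine ⟨hC, fun t => ⟨?_, ?_⟩⟩
    · by_contra! h
      linarith [h0 t, hgβ (σ t ω), hg2pos (σ t ω) _ h]
    · by_contra! h
      linarith [h0 t, hgα (σ t ω), hg2neg (σ t ω) _ h]
end

section
/- Let σ be a continuous flow on a nonempty compact metric space Ω. If σ admits exactly one minimal set, then σ is chain recurrent: for every ε > 0, every t₀ > 0 and every pair of points ω, ω̃ ∈ Ω, there exist points ω₀ := ω, ω₁, …, ω_m := ω̃ in Ω and real numbers t_0', …, t_{m−1}', each greater than t₀, such that dist(ω_i · t_i', ω_{i+1}) < ε for i = 0, …, m−1. -/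
open MeasureTheory

/-- A nonempty compact invariant set with no proper nonempty compact invariant subset. -/
def IsMinimalSet {X : Type*} [TopologicalSpace X] (φ : ℝ → X → X) (M : Set X) : Prop :=
  M.Nonempty ∧ IsCompact M ∧ (∀ t : ℝ, φ t '' M = M) ∧
    ∀ M' : Set X, M' ⊆ M → M'.Nonempty → IsCompact M' →
      (∀ t : ℝ, φ t '' M' = M') → M' = M

section MinimalSets

open Set Filter Topology

/-- A set mapped into itself by every time of a real flow is mapped onto itself. -/
theorem IsInvariant.image_eq_of_flow {X : Type*} [TopologicalSpace X] {φ : Flow ℝ X}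
    {K : Set X} (hK : IsInvariant φ K) (t : ℝ) : φ t '' K = K := by
  refine (hK t).image_subset.antisymm fun x hx => ⟨φ (-t) x, hK (-t) hx, ?_⟩
  rw [← φ.map_add, add_neg_cancel, φ.map_zero_apply]

/-- Every nonempty compact invariant set of a real flow contains a minimal set. -/
theorem exists_isMinimalSet_subset {X : Type*} [TopologicalSpace X] [T2Space X]
    (φ : Flow ℝ X) {K : Set X} (hne : K.Nonempty) (hc : IsCompact K)
    (hinv : IsInvariant φ K) : ∃ M ⊆ K, IsMinimalSet φ M := by
  obtain ⟨M, hMK, hM⟩ := zorn_superset_nonempty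
    {A : Set X | A.Nonempty ∧ IsCompact A ∧ IsInvariant φ A} (fun c hcS hchain hcne => by
      refine ⟨⋂₀ c, ⟨?_, ?_, ?_⟩, fun s hs => sInter_subset_of_mem hs⟩
      · have := hcne.to_subtype
        exact IsCompact.nonempty_sInter_of_directed_nonempty_isCompact_isClosed
          (fun A hA B hB => (hchain.total hA hB).elim
            (fun h => ⟨A, hA, subset_rfl, h⟩) (fun h => ⟨B, hB, h, subset_rfl⟩))
          (fun U hU => (hcS hU).1)
          (fun U hU => (hcS hU).2.1) (fun U hU => (hcS hU).2.1.isClosed)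
      · obtain ⟨U, hU⟩ := hcne
        exact (hcS hU).2.1.of_isClosed_subset
          (isClosed_sInter fun V hV => (hcS hV).2.1.isClosed) (sInter_subset_of_mem hU)
      · exact fun t x hx V hV => (hcS hV).2.2 t (hx V hV))
    K ⟨hne, hc, hinv⟩
  refine ⟨M, hMK, hM.prop.1, hM.prop.2.1, hM.prop.2.2.image_eq_of_flow,
    fun A hAM hAne hAc hA => hAM.antisymm (hM.le_of_le ⟨hAne, hAc, fun t => ?_⟩ hAM)⟩
  exact mapsTo_iff_image_subset.2 (hA t).subset

/-- In a compact space, the limit set of any point of a real flow contains a minimal set. -/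
theorem exists_isMinimalSet_subset_omegaLimit {X : Type*} [TopologicalSpace X] [T2Space X]
    [CompactSpace X] (φ : Flow ℝ X) (f : Filter ℝ) [NeBot f]
    (hf : ∀ t, Tendsto (t + ·) f f) (x : X) :
    ∃ M ⊆ omegaLimit f φ {x}, IsMinimalSet φ M :=
  exists_isMinimalSet_subset φ (nonempty_omegaLimit f φ {x} (singleton_nonempty x))
    (isClosed_omegaLimit f φ {x}).isCompact (φ.isInvariant_omegaLimit f {x} hf)

end MinimalSets

/-- A continuous flow on a nonempty compact metric space admitting exactly
one minimal set is chain recurrent. -/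
theorem stmt19 {Ω : Type*} [MetricSpace Ω] [CompactSpace Ω] [Nonempty Ω]
    (σ : ℝ → Ω → Ω)
    (hσcont : Continuous fun p : ℝ × Ω => σ p.1 p.2)
    (hσ0 : ∀ ω, σ 0 ω = ω)
    (hσadd : ∀ s t ω, σ (s + t) ω = σ s (σ t ω))
    (huniq : ∃! M : Set Ω, IsMinimalSet σ M) :
    ∀ ε > (0:ℝ), ∀ t₀ > (0:ℝ), ∀ ω ωt : Ω,
      ∃ n : ℕ, 1 ≤ n ∧ ∃ pts : ℕ → Ω, ∃ ts : ℕ → ℝ,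
        pts 0 = ω ∧ pts n = ωt ∧
        ∀ i < n, t₀ < ts i ∧ dist (σ (ts i) (pts i)) (pts (i + 1)) < ε := by
  intro ε hε t₀ ht₀ ω ωt
  let φ : Flow ℝ Ω := ⟨σ, hσcont, hσadd, hσ0⟩
  obtain ⟨M, hM, hMuniq⟩ := huniq
  obtain ⟨p, hp⟩ := hM.1
  have near (f : Filter ℝ) [f.NeBot] (hf : ∀ t, Filter.Tendsto (t + ·) f f) (x : Ω) :
      ∃ᶠ t in f, dist (σ t x) p < ε / 2 := by
    obtain ⟨N, hN, hNmin⟩ := exists_isMinimalSet_subset_omegaLimit φ f hf x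
    have hpx := hN (hMuniq N hNmin ▸ hp)
    rw [mem_omegaLimit_singleton_iff_mapClusterPt, mapClusterPt_iff_frequently] at hpx
    exact hpx _ (Metric.ball_mem_nhds p (half_pos hε))
  obtain ⟨s, hs, hst⟩ := ((near Filter.atTop
    (fun t => Filter.tendsto_atTop_add_const_left _ t Filter.tendsto_id) ω).and_eventually
    (Filter.eventually_gt_atTop t₀)).exists
  obtain ⟨r, hr, hrt⟩ := ((near Filter.atBot
    (fun t => Filter.tendsto_atBot_add_const_left _ t Filter.tendsto_id) ωt).and_eventually
    (Filter.eventually_lt_atBot (-t₀))).exists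
  refine ⟨2, one_le_two, fun i => if i = 0 then ω else if i = 1 then σ r ωt else ωt,
    fun i => if i = 0 then s else -r, by simp, by simp, fun i hi => ?_⟩
  interval_cases i
  · simp only [if_true, zero_add, one_ne_zero, if_false]
    exact ⟨hst, (dist_triangle_right _ _ p).trans_lt (by linarith)⟩
  · simpa [← hσadd, hσ0] using And.intro (lt_neg_of_lt_neg hrt) hε
end
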